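/- arXiv:math/0105134 — 5 statements merged into one kernel-verified Lean document; each statement's English description precedes it below -/
import Mathlib

section
/- Let M be a countable Diophantine correct model of PA⁻. Then M can be embedded into the reduced power ℕ^ω/𝓕, where 𝓕 is the cofinite filter on ℕ. That is, there exists a map h from M into the germs of functions ℕ → ℕ at the cofinite filter such that h preserves +, ·, 0 and 1, satisfies h(x) ≤ h(y) if and only if x ≤ y, is injective, and sends each standard element k·1 of M (k a natural number) to the germ of the constant function k. -/
/-- Terms of the language of arithmetic in `k` variables: these represent
polynomials with natural-number coefficients. -/
inductive ArTerm : ℕ → Type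
  | var {k : ℕ} : Fin k → ArTerm k
  | zero {k : ℕ} : ArTerm k
  | one {k : ℕ} : ArTerm k
  | add {k : ℕ} : ArTerm k → ArTerm k → ArTerm k
  | mul {k : ℕ} : ArTerm k → ArTerm k → ArTerm k

/-- Evaluation of a term in any structure with `+`, `·`, `0`, `1`. -/
def ArTerm.eval {M : Type*} [Add M] [Mul M] [Zero M] [One M] :
    ∀ {k : ℕ}, ArTerm k → (Fin k → M) → M
  | _, .var i, a => a i
  | _, .zero, _ => 0
  | _, .one, _ => 1
  | _, .add t s, a => t.eval a + s.eval a
  | _, .mul t s, a => t.eval a * s.eval a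

/-- The axioms of `PA⁻`: the nonnegative part of a discretely ordered ring. -/
class PAMinus (M : Type*) extends Add M, Mul M, Zero M, One M, LinearOrder M where
  add_assoc : ∀ x y z : M, (x + y) + z = x + (y + z)
  add_comm : ∀ x y : M, x + y = y + x
  mul_assoc : ∀ x y z : M, (x * y) * z = x * (y * z)
  mul_comm : ∀ x y : M, x * y = y * x
  mul_add : ∀ x y z : M, x * (y + z) = x * y + x * z
  add_zero : ∀ x : M, x + 0 = x
  mul_zero : ∀ x : M, x * 0 = 0
  mul_one : ∀ x : M, x * 1 = x
  add_lt_add_right : ∀ x y z : M, x < y → x + z < y + z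
  mul_lt_mul_right : ∀ x y z : M, 0 < z → x < y → x * z < y * z
  exists_add_of_lt : ∀ x y : M, x < y → ∃ z, x + z = y
  zero_lt_one : (0 : M) < 1
  one_le_of_pos : ∀ x : M, 0 < x → 1 ≤ x
  zero_le : ∀ x : M, 0 ≤ x

/-- `M` is Diophantine correct: every finite system of polynomial equations with
natural-number coefficients having a solution in `M` has a solution in `ℕ`. -/
def DiophCorrect (M : Type*) [Add M] [Mul M] [Zero M] [One M] : Prop :=
  ∀ (k : ℕ) (S : List (ArTerm k × ArTerm k)),
    (∃ a : Fin k → M, ∀ p ∈ S, p.1.eval a = p.2.eval a) →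
    (∃ v : Fin k → ℕ, ∀ p ∈ S, p.1.eval v = p.2.eval v)

/-- The standard element `k·1` of `M`. -/
def stdElem (M : Type*) [Add M] [Zero M] [One M] : ℕ → M
  | 0 => 0
  | n + 1 => stdElem M n + 1

/-- Diophantine correctness for finite sets of equations satisfied by a given tuple. -/
theorem DiophCorrect.exists_solution_of_finite {M : Type*} [Add M] [Mul M] [Zero M] [One M]
    (hM : DiophCorrect M) {k : ℕ} (a : Fin k → M) {T : Set (ArTerm k × ArTerm k)}
    (hT : T.Finite) :
    ∃ v : Fin k → ℕ, ∀ p ∈ T, p.1.eval a = p.2.eval a → p.1.eval v = p.2.eval v := by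
  have hS : (T ∩ {p | p.1.eval a = p.2.eval a}).Finite := hT.inter_of_left _
  obtain ⟨v, hv⟩ := hM k hS.toFinset.toList ⟨a, fun p hp => by simp_all⟩
  exact ⟨v, fun p hp h => hv p (by simp [hp, h])⟩

/-- A finite tuple in a Diophantine correct structure has a tuple of natural numbers satisfying
the same instances of `x + y = z`, `x * y = z`, `x = 0` and `x = 1`. -/
theorem DiophCorrect.exists_tuple {M : Type*} [Add M] [Mul M] [Zero M] [One M]
    (hM : DiophCorrect M) {k : ℕ} (a : Fin k → M) :
    ∃ v : Fin k → ℕ,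
      (∀ i j l, a i + a j = a l → v i + v j = v l) ∧
      (∀ i j l, a i * a j = a l → v i * v j = v l) ∧
      (∀ i, a i = 0 → v i = 0) ∧ (∀ i, a i = 1 → v i = 1) := by
  let sums : Fin k × Fin k × Fin k → ArTerm k × ArTerm k :=
    fun q => (.add (.var q.1) (.var q.2.1), .var q.2.2)
  let prods : Fin k × Fin k × Fin k → ArTerm k × ArTerm k :=
    fun q => (.mul (.var q.1) (.var q.2.1), .var q.2.2)
  let zeros : Fin k → ArTerm k × ArTerm k := fun i => (.var i, .zero)
  let ones : Fin k → ArTerm k × ArTerm k := fun i => (.var i, .one)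
  obtain ⟨v, hv⟩ := hM.exists_solution_of_finite a
    ((((Set.finite_range sums).union (Set.finite_range prods)).union
      (Set.finite_range zeros)).union (Set.finite_range ones))
  exact ⟨v,
    fun i j l => by
      simpa [sums, ArTerm.eval] using hv (sums (i, j, l)) (.inl (.inl (.inl ⟨_, rfl⟩))),
    fun i j l => by
      simpa [prods, ArTerm.eval] using hv (prods (i, j, l)) (.inl (.inl (.inr ⟨_, rfl⟩))),
    fun i => by
      simpa [zeros, ArTerm.eval] using hv (zeros i) (.inl (.inr ⟨_, rfl⟩)),
    fun i => by
      simpa [ones, ArTerm.eval] using hv (ones i) (.inr ⟨_, rfl⟩)⟩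

/-- A countable Diophantine correct structure has a sequence of maps to `ℕ` that preserves each
instance of the operations from some point on. -/
theorem DiophCorrect.exists_seq {M : Type*} [Add M] [Mul M] [Zero M] [One M] [Countable M]
    (hM : DiophCorrect M) :
    ∃ φ : M → ℕ → ℕ,
      (∀ x y, ∀ᶠ n in Filter.cofinite, φ (x + y) n = φ x n + φ y n) ∧
      (∀ x y, ∀ᶠ n in Filter.cofinite, φ (x * y) n = φ x n * φ y n) ∧
      (∀ᶠ n in Filter.cofinite, φ 0 n = 0) ∧ (∀ᶠ n in Filter.cofinite, φ 1 n = 1) := by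
  have : Nonempty M := ⟨0⟩
  obtain ⟨f, hf⟩ := exists_surjective_nat M
  choose e he using hf
  choose v hadd hmul hzero hone using fun n : ℕ => hM.exists_tuple fun i : Fin n => f i
  have hlt (x : M) : ∀ᶠ n in Filter.cofinite, e x < n := by
    rw [Nat.cofinite_eq_atTop]
    exact Filter.eventually_gt_atTop _
  refine ⟨fun x n => if hn : e x < n then v n ⟨e x, hn⟩ else 0,
    fun x y => ?_, fun x y => ?_, ?_, ?_⟩
  · filter_upwards [hlt x, hlt y, hlt (x + y)] with n hx hy hxy
    simpa [hx, hy, hxy] using (hadd n ⟨_, hx⟩ ⟨_, hy⟩ ⟨_, hxy⟩ (by simp [he])).symm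
  · filter_upwards [hlt x, hlt y, hlt (x * y)] with n hx hy hxy
    simpa [hx, hy, hxy] using (hmul n ⟨_, hx⟩ ⟨_, hy⟩ ⟨_, hxy⟩ (by simp [he])).symm
  · filter_upwards [hlt 0] with n h
    simpa [h] using hzero n ⟨_, h⟩ (by simp [he])
  · filter_upwards [hlt 1] with n h
    simpa [h] using hone n ⟨_, h⟩ (by simp [he])

theorem PAMinus.exists_add_add_one_of_lt {M : Type*} [PAMinus M] {x y : M} (h : x < y) :
    ∃ z, x + (z + 1) = y := by
  obtain ⟨w, rfl⟩ := PAMinus.exists_add_of_lt x y h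
  have hw : 0 < w := lt_of_le_of_ne (PAMinus.zero_le w) fun hw => by
    rw [← hw, PAMinus.add_zero] at h
    exact lt_irrefl _ h
  rcases (PAMinus.one_le_of_pos w hw).eq_or_lt with rfl | h1
  · exact ⟨0, by rw [PAMinus.add_comm 0, PAMinus.add_zero]⟩
  · obtain ⟨z, rfl⟩ := PAMinus.exists_add_of_lt 1 w h1
    exact ⟨z, by rw [PAMinus.add_comm z]⟩

/-- **Tennenbaum.** Every countable Diophantine correct model of `PA⁻` embeds into
the reduced power `ℕ^ω/𝓕`, where `𝓕` is the cofinite filter on `ℕ`. -/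
theorem countable_dioph_correct_embeds_in_reduced_power
    (M : Type*) [PAMinus M] [Countable M] (hM : DiophCorrect M) :
    ∃ h : M → (Filter.cofinite : Filter ℕ).Germ ℕ,
      Function.Injective h ∧
      (∀ x y : M, h (x + y) = h x + h y) ∧
      (∀ x y : M, h (x * y) = h x * h y) ∧
      h 0 = 0 ∧ h 1 = 1 ∧
      (∀ x y : M, h x ≤ h y ↔ x ≤ y) ∧
      (∀ k : ℕ, h (stdElem M k) = Filter.Germ.const k) := by
  obtain ⟨φ, hadd, hmul, hzero, hone⟩ := hM.exists_seq
  have hlt {x y : M} (h : x < y) : ∀ᶠ n in Filter.cofinite, φ x n < φ y n := by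
    obtain ⟨z, rfl⟩ := PAMinus.exists_add_add_one_of_lt h
    filter_upwards [hadd x (z + 1), hadd z 1, hone] with n h₁ h₂ h₃
    omega
  have hle (x y : M) : (φ x : (Filter.cofinite : Filter ℕ).Germ ℕ) ≤ φ y ↔ x ≤ y := by
    rw [Filter.Germ.coe_le]
    refine ⟨fun h => ?_, fun h => ?_⟩
    · by_contra! hyx
      obtain ⟨n, h₁, h₂⟩ := (h.and (hlt hyx)).exists
      exact h₁.not_gt h₂
    · rcases h.eq_or_lt with rfl | h
      · exact Filter.EventuallyLE.rfl
      · exact (hlt h).mono fun _ => le_of_lt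
  have hadd' (x y : M) : (φ (x + y) : (Filter.cofinite : Filter ℕ).Germ ℕ) = φ x + φ y :=
    Filter.Germ.coe_eq.2 (hadd x y)
  have hone' : (φ 1 : (Filter.cofinite : Filter ℕ).Germ ℕ) = 1 := Filter.Germ.coe_eq.2 hone
  have hzero' : (φ 0 : (Filter.cofinite : Filter ℕ).Germ ℕ) = 0 := Filter.Germ.coe_eq.2 hzero
  refine ⟨fun x => φ x, fun x y h => le_antisymm ((hle x y).1 h.le) ((hle y x).1 h.ge), hadd',
    fun x y => Filter.Germ.coe_eq.2 (hmul x y), hzero', hone', hle, fun k => ?_⟩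
  induction k with
  | zero => exact hzero'
  | succ k ih =>
    calc (φ (stdElem M k + 1) : (Filter.cofinite : Filter ℕ).Germ ℕ)
      _ = φ (stdElem M k) + φ 1 := hadd' _ _
      _ = Filter.Germ.const k + 1 := congrArg₂ (· + ·) ih hone'
      _ = Filter.Germ.const (k + 1) := rfl
end

section
/- Let M be a countable model of the universal theory of ℕ in the language of arithmetic, i.e. a structure (M, +, ·, 0, 1, ≤) such that every finite conjunction of conditions of the form p(x̄)=q(x̄), p(x̄)≠q(x̄), p(x̄)≤q(x̄), or ¬(p(x̄)≤q(x̄)) — where p and q are polynomials with natural-number coefficients — which is satisfied by some tuple of elements of M is also satisfied by some tuple of natural numbers. Then M can be embedded into ℕ^ω/𝓕: there is an injective map h from M into the germs of functions ℕ → ℕ at the cofinite filter preserving +, ·, 0, 1 and satisfying h(x) ≤ h(y) if and only if x ≤ y. -/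
/-- A tuple `a` satisfies a finite conjunction of conditions `p = q`, `p ≠ q`,
`p ≤ q`, `¬ p ≤ q` given by four lists of pairs of terms. -/
def SatisfiesConds {M : Type*} [Add M] [Mul M] [Zero M] [One M] [LE M] {k : ℕ}
    (Eq Ne Le NLe : List (ArTerm k × ArTerm k)) (a : Fin k → M) : Prop :=
  (∀ p ∈ Eq, p.1.eval a = p.2.eval a) ∧
  (∀ p ∈ Ne, p.1.eval a ≠ p.2.eval a) ∧
  (∀ p ∈ Le, p.1.eval a ≤ p.2.eval a) ∧
  (∀ p ∈ NLe, ¬ p.1.eval a ≤ p.2.eval a)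

/-- `M` is a model of the universal (∀₁) theory of `ℕ`: every finite conjunction
of literal conditions satisfiable in `M` is satisfiable in `ℕ`. -/
def ModelsUnivThN (M : Type*) [Add M] [Mul M] [Zero M] [One M] [LE M] : Prop :=
  ∀ (k : ℕ) (Eq Ne Le NLe : List (ArTerm k × ArTerm k)),
    (∃ a : Fin k → M, SatisfiesConds Eq Ne Le NLe a) →
    (∃ v : Fin k → ℕ, SatisfiesConds Eq Ne Le NLe v)

/-- In a model of the universal theory of `ℕ`, the atomic relations between the values of finitely
many terms at a tuple are the same as those at some tuple of natural numbers. -/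
theorem ModelsUnivThN.exists_nat_tuple {M : Type*} [Add M] [Mul M] [Zero M] [One M] [LE M]
    (hM : ModelsUnivThN M) {k : ℕ} (a : Fin k → M) {T : Set (ArTerm k)} (hT : T.Finite) :
    ∃ v : Fin k → ℕ, ∀ t ∈ T, ∀ s ∈ T,
      (t.eval v = s.eval v ↔ t.eval a = s.eval a) ∧
      (t.eval v ≤ s.eval v ↔ t.eval a ≤ s.eval a) := by
  classical
  let L := (hT.prod hT).toFinset.toList
  have mem_L : ∀ t ∈ T, ∀ s ∈ T, (t, s) ∈ L := fun t ht s hs => by simp [L, ht, hs]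
  obtain ⟨v, hEq, hNe, hLe, hNLe⟩ := hM k
    (L.filter fun p => p.1.eval a = p.2.eval a)
    (L.filter fun p => p.1.eval a ≠ p.2.eval a)
    (L.filter fun p => p.1.eval a ≤ p.2.eval a)
    (L.filter fun p => ¬ p.1.eval a ≤ p.2.eval a)
    ⟨a, fun p hp => of_decide_eq_true (List.mem_filter.1 hp).2,
      fun p hp => of_decide_eq_true (List.mem_filter.1 hp).2,
      fun p hp => of_decide_eq_true (List.mem_filter.1 hp).2,
      fun p hp => of_decide_eq_true (List.mem_filter.1 hp).2⟩
  refine ⟨v, fun t ht s hs => ⟨⟨fun h => ?_, fun h => ?_⟩, ⟨fun h => ?_, fun h => ?_⟩⟩⟩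
  · by_contra h'
    exact hNe (t, s) (List.mem_filter.2 ⟨mem_L t ht s hs, decide_eq_true h'⟩) h
  · exact hEq (t, s) (List.mem_filter.2 ⟨mem_L t ht s hs, decide_eq_true h⟩)
  · by_contra h'
    exact hNLe (t, s) (List.mem_filter.2 ⟨mem_L t ht s hs, decide_eq_true h'⟩) h
  · exact hLe (t, s) (List.mem_filter.2 ⟨mem_L t ht s hs, decide_eq_true h⟩)

/-- A finite subset of a model of the universal theory of `ℕ` can be mapped to `ℕ` so that all
atomic relations between its elements are preserved and reflected. -/
theorem ModelsUnivThN.exists_nat_map {M : Type*} [Add M] [Mul M] [Zero M] [One M] [LE M]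
    (hM : ModelsUnivThN M) (S : Finset M) :
    ∃ g : M → ℕ,
      (∀ x ∈ S, ∀ y ∈ S, (g x = g y ↔ x = y) ∧ (g x ≤ g y ↔ x ≤ y)) ∧
      (∀ x ∈ S, ∀ y ∈ S, x + y ∈ S → g (x + y) = g x + g y) ∧
      (∀ x ∈ S, ∀ y ∈ S, x * y ∈ S → g (x * y) = g x * g y) ∧
      (0 ∈ S → g 0 = 0) ∧ (1 ∈ S → g 1 = 1) := by
  classical
  let a : Fin S.card → M := fun i => S.equivFin.symm i
  let T : Set (ArTerm S.card) :=
    Set.range .var ∪ {.zero, .one} ∪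
      Set.range (fun p : Fin S.card × Fin S.card => .add (.var p.1) (.var p.2)) ∪
      Set.range (fun p : Fin S.card × Fin S.card => .mul (.var p.1) (.var p.2))
  obtain ⟨v, hv⟩ := hM.exists_nat_tuple a (T := T) (Set.toFinite T)
  have var_mem (i) : ArTerm.var i ∈ T := .inl (.inl (.inl ⟨i, rfl⟩))
  have zero_mem : ArTerm.zero ∈ T := .inl (.inl (.inr (.inl rfl)))
  have one_mem : ArTerm.one ∈ T := .inl (.inl (.inr (.inr rfl)))
  have add_mem (i j) : ArTerm.add (.var i) (.var j) ∈ T := .inl (.inr ⟨(i, j), rfl⟩)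
  have mul_mem (i j) : ArTerm.mul (.var i) (.var j) ∈ T := .inr ⟨(i, j), rfl⟩
  let g : M → ℕ := fun x => if hx : x ∈ S then v (S.equivFin ⟨x, hx⟩) else 0
  have exists_index : ∀ x ∈ S, ∃ i, a i = x ∧ v i = g x := fun x hx =>
    ⟨S.equivFin ⟨x, hx⟩, by simp [a], by simp [g, hx]⟩
  refine ⟨g, fun x hx y hy => ?_, fun x hx y hy hxy => ?_, fun x hx y hy hxy => ?_,
    fun h => ?_, fun h => ?_⟩
  · obtain ⟨i, rfl, hi⟩ := exists_index x hx
    obtain ⟨j, rfl, hj⟩ := exists_index y hy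
    rw [← hi, ← hj]
    simpa only [ArTerm.eval] using hv _ (var_mem i) _ (var_mem j)
  · obtain ⟨i, hai, hi⟩ := exists_index x hx
    obtain ⟨j, haj, hj⟩ := exists_index y hy
    obtain ⟨l, hal, hl⟩ := exists_index _ hxy
    rw [← hi, ← hj, ← hl]
    have h := (hv _ (var_mem l) _ (add_mem i j)).1
    simp only [ArTerm.eval] at h
    rw [h, hai, haj, hal]
  · obtain ⟨i, hai, hi⟩ := exists_index x hx
    obtain ⟨j, haj, hj⟩ := exists_index y hy
    obtain ⟨l, hal, hl⟩ := exists_index _ hxy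
    rw [← hi, ← hj, ← hl]
    have h := (hv _ (var_mem l) _ (mul_mem i j)).1
    simp only [ArTerm.eval] at h
    rw [h, hai, haj, hal]
  · obtain ⟨i, hai, hi⟩ := exists_index _ h
    rw [← hi]
    have h' := (hv _ (var_mem i) _ zero_mem).1
    simp only [ArTerm.eval] at h'
    exact h'.2 hai
  · obtain ⟨i, hai, hi⟩ := exists_index _ h
    rw [← hi]
    have h' := (hv _ (var_mem i) _ one_mem).1
    simp only [ArTerm.eval] at h'
    exact h'.2 hai

/-- Every countable model of the universal theory of `ℕ` embeds into the reduced
power `ℕ^ω/𝓕`, where `𝓕` is the cofinite filter on `ℕ`. -/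
theorem countable_model_univ_th_embeds_in_reduced_power
    (M : Type*) [Add M] [Mul M] [Zero M] [One M] [LE M] [Countable M]
    (hM : ModelsUnivThN M) :
    ∃ h : M → (Filter.cofinite : Filter ℕ).Germ ℕ,
      Function.Injective h ∧
      (∀ x y : M, h (x + y) = h x + h y) ∧
      (∀ x y : M, h (x * y) = h x * h y) ∧
      h 0 = 0 ∧ h 1 = 1 ∧
      (∀ x y : M, h x ≤ h y ↔ x ≤ y) := by
  classical
  have : Nonempty M := ⟨0⟩
  obtain ⟨e, he⟩ := exists_surjective_nat M
  choose g hg hadd hmul hzero hone using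
    fun n => hM.exists_nat_map ((Finset.range n).image e)
  have eventually_mem (x : M) :
      ∀ᶠ n in Filter.cofinite, x ∈ (Finset.range n).image e := by
    obtain ⟨m, rfl⟩ := he x
    rw [Nat.cofinite_eq_atTop]
    filter_upwards [Filter.eventually_gt_atTop m] with n hn
    exact Finset.mem_image_of_mem e (Finset.mem_range.2 hn)
  refine ⟨fun x => ((fun n => g n x : ℕ → ℕ) : (Filter.cofinite : Filter ℕ).Germ ℕ),
    fun x y hxy => ?_, fun x y => ?_, fun x y => ?_, ?_, ?_, fun x y => ⟨fun hxy => ?_, fun hxy => ?_⟩⟩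
  · obtain ⟨n, hn, hx, hy⟩ := ((Filter.Germ.coe_eq.1 hxy).and
      ((eventually_mem x).and (eventually_mem y))).exists
    exact (hg n x hx y hy).1.1 hn
  · refine Filter.Germ.coe_eq.2 ?_
    filter_upwards [eventually_mem x, eventually_mem y, eventually_mem (x + y)] with n hx hy hxy
    exact hadd n x hx y hy hxy
  · refine Filter.Germ.coe_eq.2 ?_
    filter_upwards [eventually_mem x, eventually_mem y, eventually_mem (x * y)] with n hx hy hxy
    exact hmul n x hx y hy hxy
  · refine Filter.Germ.coe_eq.2 ?_
    filter_upwards [eventually_mem 0] with n h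
    exact hzero n h
  · refine Filter.Germ.coe_eq.2 ?_
    filter_upwards [eventually_mem 1] with n h
    exact hone n h
  · obtain ⟨n, hn, hx, hy⟩ := ((Filter.Germ.coe_le.1 hxy).and
      ((eventually_mem x).and (eventually_mem y))).exists
    exact (hg n x hx y hy).2.1 hn
  · refine Filter.Germ.coe_le.2 ?_
    filter_upwards [eventually_mem x, eventually_mem y] with n hx hy
    exact (hg n x hx y hy).2.2 hxy
end

section
/- Let M be a countable model of PA⁻ (not necessarily Diophantine correct). Then M can be embedded into 𝔸^ω/𝓕, where 𝔸 is the set of nonnegative real algebraic numbers: there exists an injective map h from M into the germs of functions ℕ → ℝ at the cofinite filter such that h preserves +, ·, 0 and 1, satisfies h(x) ≤ h(y) if and only if x ≤ y, and every element of the image of h has a representative function all of whose values are nonnegative real numbers algebraic over ℚ. -/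
open Polynomial

/-- The intermediate value property for polynomials over an ordered field. -/
def PolynomialIVT (K : Type*) [Field K] [LinearOrder K] : Prop :=
  ∀ (f : K[X]) (a b : K), a < b → f.eval a * f.eval b < 0 →
    ∃ c, a < c ∧ c < b ∧ f.eval c = 0

section IntermediateValue

variable {K : Type*} [Field K] [LinearOrder K] [IsStrictOrderedRing K]

theorem sign_eq_of_mul_pos {a b : K} (h : 0 < a * b) : SignType.sign a = SignType.sign b := by
  rcases pos_and_pos_or_neg_and_neg_of_mul_pos h with ⟨ha, hb⟩ | ⟨ha, hb⟩
  · rw [sign_pos ha, sign_pos hb]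
  · rw [sign_neg ha, sign_neg hb]

theorem mul_neg_of_sign_ne {a b : K} (ha : a ≠ 0) (hb : b ≠ 0)
    (h : SignType.sign a ≠ SignType.sign b) : a * b < 0 := by
  refine lt_of_le_of_ne (not_lt.1 fun hab => h (sign_eq_of_mul_pos hab)) (mul_ne_zero ha hb)

theorem PolynomialIVT.sign_eq (hK : PolynomialIVT K) (f : K[X]) {a b : K} (hab : a ≤ b)
    (h : ∀ c, a ≤ c → c ≤ b → f.eval c ≠ 0) :
    SignType.sign (f.eval a) = SignType.sign (f.eval b) := by
  by_contra hne
  rcases hab.eq_or_lt with rfl | hlt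
  · exact hne rfl
  obtain ⟨c, hac, hcb, hc⟩ :=
    hK f a b hlt (mul_neg_of_sign_ne (h a le_rfl hab) (h b hab le_rfl) hne)
  exact h c hac.le hcb.le hc

/-- A weak form of Rolle's theorem. -/
theorem PolynomialIVT.exists_eval_derivative_eq_zero (hK : PolynomialIVT K) {f : K[X]}
    (hf : f ≠ 0) {x r : K} (hxr : x < r) (hx : f.eval x = 0) (hr : f.eval r = 0) :
    ∃ c, x ≤ c ∧ c ≤ r ∧ f.derivative.eval c = 0 := by
  classical
  obtain ⟨s, hs, hmin⟩ := (f.roots.toFinset.filter fun s => x < s).exists_min_image id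
    ⟨r, by simp [hf, hr, hxr]⟩
  simp only [Finset.mem_filter, Multiset.mem_toFinset, mem_roots hf, IsRoot, id] at hs hmin
  obtain ⟨hs0, hxs⟩ := hs
  obtain ⟨p, rfl⟩ := dvd_iff_isRoot.2 hx
  have hp : p.eval s = 0 := by
    simpa [sub_eq_zero, hxs.ne'] using hs0
  obtain ⟨q, rfl⟩ := dvd_iff_isRoot.2 hp
  have hsr : s ≤ r := hmin r ⟨hr, hxr⟩
  have dx : (derivative ((X - C x) * ((X - C s) * q))).eval x = (x - s) * q.eval x := by
    simp
  have ds : (derivative ((X - C x) * ((X - C s) * q))).eval s = (s - x) * q.eval s := by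
    simp
  by_cases hqx : q.eval x = 0
  · exact ⟨x, le_rfl, hxr.le, by rw [dx, hqx, mul_zero]⟩
  by_cases hqs : q.eval s = 0
  · exact ⟨s, hxs.le, hsr, by rw [ds, hqs, mul_zero]⟩
  have hsign : SignType.sign (q.eval x) = SignType.sign (q.eval s) := by
    refine hK.sign_eq q hxs.le fun c hxc hcs hc => ?_
    rcases hxc.eq_or_lt with rfl | hxc
    · exact hqx hc
    · have := hmin c ⟨by simp [hc], hxc⟩
      exact hqs (le_antisymm hcs this ▸ hc)
  have hpos : 0 < q.eval x * q.eval s := by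
    rcases lt_or_gt_of_ne hqx with h1 | h1 <;> rcases lt_or_gt_of_ne hqs with h2 | h2
    · exact mul_pos_of_neg_of_neg h1 h2
    · simp [sign_neg h1, sign_pos h2] at hsign
    · simp [sign_neg h2, sign_pos h1] at hsign
    · exact mul_pos h1 h2
  obtain ⟨c, hxc, hcs, hc⟩ := hK _ x s hxs (by
    rw [dx, ds]
    have : 0 < (s - x) * (s - x) := mul_pos (sub_pos.2 hxs) (sub_pos.2 hxs)
    nlinarith [mul_pos this hpos])
  exact ⟨c, hxc.le, hcs.le.trans hsr, hc⟩

end IntermediateValue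

section BackAndForth

universe u v

variable {F K L : Type*} [Field F]
  [Field K] [LinearOrder K] [Field L] [LinearOrder L]

/-- Polynomials over `F` of degree less than `n` have all their roots in `F`. -/
def RootsInRange (i : F →+* K) (n : ℕ) : Prop :=
  ∀ g : F[X], g ≠ 0 → g.natDegree < n → ∀ x, g.eval₂ i x = 0 → x ∈ Set.range i

/-- `x` and `y` are outside of `F` and determine the same cut of `F`. -/
structure SameCut (i : F →+* K) (j : F →+* L) (x : K) (y : L) : Prop where
  left : x ∉ Set.range i
  right : y ∉ Set.range j
  lt_iff : ∀ c, i c < x ↔ j c < y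

/-- The pair `(i, j)` cannot be extended to an order isomorphism between larger subrings. -/
def IsMaximalPair (i : F →+* K) (j : F →+* L) : Prop :=
  ∀ x y, (∀ g : F[X], 0 < g.eval₂ i x ↔ 0 < g.eval₂ j y) → ∃ c, i c = x ∧ j c = y

theorem IsMaximalPair.symm {i : F →+* K} {j : F →+* L} (h : IsMaximalPair i j) :
    IsMaximalPair j i := fun x y hxy => by
  obtain ⟨c, h1, h2⟩ := h y x fun g => (hxy g).symm
  exact ⟨c, h2, h1⟩

theorem pos_iff_of_sign_eq {a : K} {b : L} (h : SignType.sign a = SignType.sign b) :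
    0 < a ↔ 0 < b := by
  rw [← sign_eq_one_iff, h, sign_eq_one_iff]

theorem StrictMono.sign_map_eq [LinearOrder F] {i : F →+* K} {j : F →+* L} (hi : StrictMono i)
    (hj : StrictMono j) (c : F) : SignType.sign (i c) = SignType.sign (j c) := by
  rcases lt_trichotomy c 0 with h | rfl | h
  · rw [sign_neg (by simpa using hi h), sign_neg (by simpa using hj h)]
  · simp
  · rw [sign_pos (by simpa using hi h), sign_pos (by simpa using hj h)]

variable [IsStrictOrderedRing K] [IsStrictOrderedRing L]

theorem PolynomialIVT.sign_eval₂_eq_zero_point (hK : PolynomialIVT K) {i : F →+* K} {n : ℕ}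
    (hi : RootsInRange i n) {g : F[X]} (hg : g ≠ 0) (hn : g.natDegree < n)
    (hroot : ∀ c, g.eval c ≠ 0) (x : K) :
    SignType.sign (g.eval₂ i x) = SignType.sign (i (g.eval 0)) := by
  have key : ∀ c, (g.map i).eval c ≠ 0 := by
    intro c hc
    rw [eval_map] at hc
    obtain ⟨d, rfl⟩ := hi g hg hn c hc
    rw [eval₂_hom, map_eq_zero] at hc
    exact hroot d hc
  have h0 : i (g.eval 0) = (g.map i).eval 0 := by
    rw [eval_map, ← map_zero i, eval₂_hom]
  rw [← eval_map, h0]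
  rcases le_total x 0 with h | h
  · exact hK.sign_eq _ h fun c _ _ => key c
  · exact (hK.sign_eq _ h fun c _ _ => key c).symm

theorem SameCut.sign_eval₂_eq [LinearOrder F] (hK : PolynomialIVT K) (hL : PolynomialIVT L)
    {i : F →+* K} {j : F →+* L} (hi : StrictMono i) (hj : StrictMono j) {n : ℕ}
    (hin : RootsInRange i n) (hjn : RootsInRange j n) {x : K} {y : L} (hxy : SameCut i j x y)
    (g : F[X]) (hg : g.natDegree < n) :
    SignType.sign (g.eval₂ i x) = SignType.sign (g.eval₂ j y) := by
  induction hd : g.natDegree using Nat.strong_induction_on generalizing g with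
  | _ d ih =>
  subst hd
  by_cases g0 : g = 0
  · simp [g0]
  by_cases hroot : ∃ c, g.eval c = 0
  · obtain ⟨c, hc⟩ := hroot
    obtain ⟨q, rfl⟩ := dvd_iff_isRoot.2 hc
    have q0 : q ≠ 0 := right_ne_zero_of_mul g0
    have hdeg : q.natDegree < ((X - C c) * q).natDegree := by
      rw [natDegree_mul (X_sub_C_ne_zero c) q0, natDegree_X_sub_C]; omega
    have hq := ih _ hdeg q (hdeg.trans hg) rfl
    simp only [eval₂_mul, eval₂_sub, eval₂_X, eval₂_C, sign_mul, hq]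
    congr 1
    rcases lt_trichotomy (i c) x with h | h | h
    · rw [sign_pos (sub_pos.2 h), sign_pos (sub_pos.2 ((hxy.lt_iff c).1 h))]
    · exact absurd ⟨c, h⟩ hxy.left
    · have : y < j c := lt_of_le_of_ne (not_lt.1 fun h' => h.not_gt ((hxy.lt_iff c).2 h'))
        fun h' => hxy.right ⟨c, h'.symm⟩
      rw [sign_neg (sub_neg.2 h), sign_neg (sub_neg.2 this)]
  · push Not at hroot
    rw [hK.sign_eval₂_eq_zero_point hin g0 hg hroot, hL.sign_eval₂_eq_zero_point hjn g0 hg hroot,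
      hi.sign_map_eq hj]

theorem eval₂_ne_zero_of_forall_lt_abs {i : F →+* K} {x : K} (hx : ∀ c, i c < |x|) (g : F[X])
    (hg : g ≠ 0) : g.eval₂ i x ≠ 0 := by
  suffices ∃ e, 0 < i e ∧ i e ≤ |g.eval₂ i x| by
    obtain ⟨e, he, hle⟩ := this
    exact abs_pos.1 (he.trans_le hle)
  induction hd : g.natDegree using Nat.strong_induction_on generalizing g with
  | _ d ih =>
  subst hd
  have hsq : ∀ c, |i c| ≤ i (c ^ 2 + 1) := by
    intro c
    rw [map_add, map_pow, map_one, abs_le]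
    constructor <;> nlinarith [sq_nonneg (i c + 1), sq_nonneg (i c - 1), sq_nonneg (i c)]
  have hdecomp := divX_mul_X_add g
  by_cases hdeg : g.natDegree = 0
  · obtain ⟨c, rfl⟩ := natDegree_eq_zero.1 hdeg
    have hc : c ≠ 0 := by simpa using hg
    have : i c ≠ 0 := by simpa using hc
    rw [eval₂_C]
    rcases lt_or_gt_of_ne this with h | h
    · exact ⟨-c, by simpa using h, by simpa using neg_le_abs (i c)⟩
    · exact ⟨c, h, le_abs_self _⟩
  · have hq0 : g.divX ≠ 0 := fun h => hdeg (by
      rw [divX_eq_zero_iff] at h; rw [h, natDegree_C])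
    obtain ⟨e, he, hle⟩ := ih g.divX.natDegree (by rw [natDegree_divX_eq_natDegree_tsub_one]; omega)
      g.divX hq0 rfl
    refine ⟨1, by simp, ?_⟩
    have hev : g.eval₂ i x = g.divX.eval₂ i x * x + i (g.coeff 0) := by
      conv_lhs => rw [← hdecomp]
      simp
    have h1 := hx (((g.coeff 0) ^ 2 + 2) / e)
    rw [map_div₀, div_lt_iff₀ he] at h1
    have h2 := hsq (g.coeff 0)
    have h3 : |x| * i e ≤ |g.divX.eval₂ i x * x| := by
      rw [abs_mul, mul_comm]; gcongr
    have h4 := abs_sub_abs_le_abs_add (g.divX.eval₂ i x * x) (i (g.coeff 0))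
    simp only [map_add, map_pow, map_one, map_ofNat] at h1 h2 ⊢
    rw [hev]
    linarith

theorem exists_root_sameCut [LinearOrder F] (hK : PolynomialIVT K) (hL : PolynomialIVT L)
    {i : F →+* K} {j : F →+* L} (hi : StrictMono i) (hj : StrictMono j) {f : F[X]} (hf : f ≠ 0)
    (hin : RootsInRange i f.natDegree) {x : K} (hx : f.eval₂ i x = 0) (hxi : x ∉ Set.range i) :
    ∃ y, SameCut i j x y ∧ f.eval₂ j y = 0 := by
  classical
  have : CharZero F := (RingHom.charZero_iff i.injective).2 inferInstance
  have hroot : ∀ c, f.eval c ≠ 0 := by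
    intro c hc
    obtain ⟨q, hq⟩ := dvd_iff_isRoot.2 hc
    have q0 : q ≠ 0 := by rintro rfl; simp [hf] at hq
    have hdeg : q.natDegree < f.natDegree := by
      rw [hq, natDegree_mul (X_sub_C_ne_zero c) q0, natDegree_X_sub_C]; omega
    rw [hq, eval₂_mul, mul_eq_zero] at hx
    rcases hx with hx | hx
    · exact hxi ⟨c, by simpa using (sub_eq_zero.1 (by simpa using hx)).symm⟩
    · exact hxi (hin q q0 hdeg x hx)
  have hdeg0 : f.natDegree ≠ 0 := by
    intro h
    obtain ⟨c, rfl⟩ := natDegree_eq_zero.1 h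
    simp at hx hf
    exact hf hx
  have hder0 : derivative f ≠ 0 := fun h => hdeg0 (derivative_eq_zero.1 h)
  have hder : ∀ c, (derivative (f.map i)).eval c = 0 → c ∈ Set.range i := fun c hc =>
    hin _ hder0 (natDegree_derivative_lt hdeg0) c (by rwa [derivative_map, eval_map] at hc)
  have hfi : f.map i ≠ 0 := (Polynomial.map_ne_zero_iff i.injective).2 hf
  have hfj : f.map j ≠ 0 := (Polynomial.map_ne_zero_iff j.injective).2 hf
  have hrange : ∀ c, (f.map i).eval (i c) ≠ 0 := fun c => by
    rw [eval_map, eval₂_hom]; simpa using hroot c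
  have hrangej : ∀ c, (f.map j).eval (j c) ≠ 0 := fun c => by
    rw [eval_map, eval₂_hom]; simpa using hroot c
  rw [← eval_map] at hx
  have hsep : ∀ r, (f.map i).eval r = 0 → r ≠ x →
      ∃ c, (r < i c ∧ i c < x) ∨ (x < i c ∧ i c < r) := by
    intro r hr hrx
    rcases lt_or_gt_of_ne hrx with h | h
    · obtain ⟨c, h1, h2, h3⟩ := hK.exists_eval_derivative_eq_zero hfi h hr hx
      obtain ⟨c, rfl⟩ := hder c h3
      exact ⟨c, .inl ⟨h1.lt_of_ne fun h => hrange c (h ▸ hr),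
        h2.lt_of_ne fun h => hrange c (h ▸ hx)⟩⟩
    · obtain ⟨c, h1, h2, h3⟩ := hK.exists_eval_derivative_eq_zero hfi h hx hr
      obtain ⟨c, rfl⟩ := hder c h3
      exact ⟨c, .inr ⟨h1.lt_of_ne fun h => hrange c (h ▸ hx),
        h2.lt_of_ne fun h => hrange c (h ▸ hr)⟩⟩
  by_contra! hcon
  have hsepj : ∀ y, (f.map j).eval y = 0 → ∃ c, (i c < x ∧ y ≤ j c) ∨ (x < i c ∧ j c ≤ y) := by
    intro y hy
    by_contra! hc
    refine hcon y ⟨hxi, ?_, fun c => ⟨fun h => (hc c).1 h, fun h => ?_⟩⟩ (by rwa [eval_map] at hy)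
    · rintro ⟨c, rfl⟩; exact hrangej c hy
    · by_contra h'
      exact lt_asymm h ((hc c).2 (lt_of_le_of_ne (not_lt.1 h') fun h => hxi ⟨c, h.symm⟩))
  have hlow : Nonempty {d // i d < x} := by
    by_contra h
    refine eval₂_ne_zero_of_forall_lt_abs (i := i) (x := x) (fun c => ?_) f hf
      (by rwa [eval_map] at hx)
    rw [nonempty_subtype, not_exists] at h
    have := not_lt.1 (h (-c))
    rw [map_neg] at this
    exact lt_of_lt_of_le ((le_neg.1 this).lt_of_ne fun h => hxi ⟨-c, by rw [map_neg, h, neg_neg]⟩)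
      (neg_le_abs x)
  have hhigh : Nonempty {e // x < i e} := by
    by_contra h
    refine eval₂_ne_zero_of_forall_lt_abs (i := i) (x := x) (fun c => ?_) f hf
      (by rwa [eval_map] at hx)
    rw [nonempty_subtype, not_exists] at h
    exact lt_of_lt_of_le ((not_lt.1 (h c)).lt_of_ne fun h => hxi ⟨c, h⟩) (le_abs_self x)
  have ev1 : ∀ᶠ p : {d // i d < x} × {e // x < i e} in Filter.atTop ×ˢ Filter.atBot,
      ∀ r ∈ (f.map i).roots.toFinset, r ≠ x → r < i p.1 ∨ i p.2 < r := by
    refine (Finset.eventually_all _).2 fun r hr => ?_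
    by_cases hrx : r = x
    · simp [hrx]
    simp only [Multiset.mem_toFinset, mem_roots hfi, IsRoot] at hr
    obtain ⟨c, ⟨h1, h2⟩ | ⟨h1, h2⟩⟩ := hsep r hr hrx
    · filter_upwards [(Filter.eventually_ge_atTop (⟨c, h2⟩ : {d // i d < x})).prod_inl _]
        with p hp _
      exact .inl (h1.trans_le (hi.monotone hp))
    · filter_upwards [(Filter.eventually_le_atBot (⟨c, h1⟩ : {e // x < i e})).prod_inr _]
        with p hp _
      exact .inr ((hi.monotone hp).trans_lt h2)
  have ev2 : ∀ᶠ p : {d // i d < x} × {e // x < i e} in Filter.atTop ×ˢ Filter.atBot,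
      ∀ r ∈ (f.map j).roots.toFinset, r ≤ j p.1 ∨ j p.2 ≤ r := by
    refine (Finset.eventually_all _).2 fun r hr => ?_
    simp only [Multiset.mem_toFinset, mem_roots hfj, IsRoot] at hr
    obtain ⟨c, ⟨h1, h2⟩ | ⟨h1, h2⟩⟩ := hsepj r hr
    · filter_upwards [(Filter.eventually_ge_atTop (⟨c, h1⟩ : {d // i d < x})).prod_inl _] with p hp
      exact .inl (h2.trans (hj.monotone hp))
    · filter_upwards [(Filter.eventually_le_atBot (⟨c, h1⟩ : {e // x < i e})).prod_inr _] with p hp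
      exact .inr ((hj.monotone hp).trans h2)
  obtain ⟨⟨⟨d, hd⟩, ⟨e, he⟩⟩, h1, h2⟩ := (ev1.and ev2).exists
  simp only [Multiset.mem_toFinset, mem_roots hfi, mem_roots hfj, IsRoot] at h1 h2
  obtain ⟨q, hq⟩ := dvd_iff_isRoot.2 hx
  have hqsign : SignType.sign (q.eval (i d)) = SignType.sign (q.eval (i e)) := by
    refine hK.sign_eq q (hd.trans he).le fun c hdc hce hc => ?_
    by_cases hcx : c = x
    · subst hcx
      exact hxi (hder c (by rw [hq]; simp [hc]))
    · rcases h1 c (by rw [hq]; simp [hc]) hcx with h | h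
      · exact h.not_ge hdc
      · exact h.not_ge hce
  have hsign : SignType.sign (f.eval d) ≠ SignType.sign (f.eval e) := by
    have hev : ∀ c, SignType.sign (f.eval c) = SignType.sign ((f.map i).eval (i c)) := by
      intro c
      rw [eval_map, eval₂_hom]
      rcases lt_trichotomy (f.eval c) 0 with h | h | h
      · rw [sign_neg h, sign_neg (by simpa using hi h)]
      · simp [h]
      · rw [sign_pos h, sign_pos (by simpa using hi h)]
    rw [hev, hev, hq, eval_mul, eval_mul, sign_mul, sign_mul, hqsign]
    have hqe : SignType.sign (q.eval (i e)) ≠ 0 := by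
      rw [sign_ne_zero]
      intro h
      exact hrange e (by rw [hq, eval_mul, h, mul_zero])
    simp only [eval_sub, eval_X, eval_C, sign_neg (sub_neg.2 hd), sign_pos (sub_pos.2 he)]
    revert hqe
    generalize SignType.sign (q.eval (i e)) = s
    revert s; decide
  have hneg : (f.map j).eval (j d) * (f.map j).eval (j e) < 0 := by
    refine mul_neg_of_sign_ne (hrangej d) (hrangej e) ?_
    have hev : ∀ c, SignType.sign (f.eval c) = SignType.sign ((f.map j).eval (j c)) := by
      intro c
      rw [eval_map, eval₂_hom]
      rcases lt_trichotomy (f.eval c) 0 with h | h | h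
      · rw [sign_neg h, sign_neg (by simpa using hj h)]
      · simp [h]
      · rw [sign_pos h, sign_pos (by simpa using hj h)]
    rwa [← hev, ← hev]
  obtain ⟨y, hdy, hye, hy⟩ := hL _ _ _ (hj (hi.lt_iff_lt.1 (hd.trans he))) hneg
  rcases h2 y hy with h | h
  · exact h.not_gt hdy
  · exact h.not_gt hye

theorem IsMaximalPair.mem_range_of_natDegree [LinearOrder F] (hK : PolynomialIVT K)
    (hL : PolynomialIVT L) {i : F →+* K} {j : F →+* L} (hi : StrictMono i) (hj : StrictMono j)
    (hmax : IsMaximalPair i j) {f : F[X]} (hf : f ≠ 0) (hin : RootsInRange i f.natDegree)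
    (hjn : RootsInRange j f.natDegree) {x : K} (hx : f.eval₂ i x = 0) : x ∈ Set.range i := by
  by_contra hxi
  obtain ⟨y, hxy, hy⟩ := exists_root_sameCut hK hL hi hj hf hin hx hxi
  have hdeg0 : f.natDegree ≠ 0 := by
    intro h
    obtain ⟨c, rfl⟩ := natDegree_eq_zero.1 h
    simp at hx hf
    exact hf hx
  obtain ⟨c, hc, -⟩ := hmax x y fun g => by
    have hg := EuclideanDomain.div_add_mod g f
    rw [← hg]
    simp only [eval₂_add, eval₂_mul, hx, hy, zero_mul, zero_add]
    exact pos_iff_of_sign_eq (hxy.sign_eval₂_eq hK hL hi hj hin hjn _ (natDegree_mod_lt g hdeg0))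
  exact hxi ⟨c, hc⟩

theorem IsMaximalPair.rootsInRange [LinearOrder F] (hK : PolynomialIVT K) (hL : PolynomialIVT L)
    {i : F →+* K} {j : F →+* L} (hi : StrictMono i) (hj : StrictMono j)
    (hmax : IsMaximalPair i j) (n : ℕ) : RootsInRange i n ∧ RootsInRange j n := by
  induction n with
  | zero =>
    exact ⟨fun _ _ h => absurd h (Nat.not_lt_zero _), fun _ _ h => absurd h (Nat.not_lt_zero _)⟩
  | succ n ih =>
    refine ⟨fun g hg hgn x hx => ?_, fun g hg hgn x hx => ?_⟩
    · rcases (Nat.lt_succ_iff.1 hgn).lt_or_eq with h | rfl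
      · exact ih.1 g hg h x hx
      · exact hmax.mem_range_of_natDegree hK hL hi hj hg ih.1 ih.2 hx
    · rcases (Nat.lt_succ_iff.1 hgn).lt_or_eq with h | rfl
      · exact ih.2 g hg h x hx
      · exact hmax.symm.mem_range_of_natDegree hL hK hj hi hg ih.2 ih.1 hx

/-- Cuts between countable sets are filled. -/
def CountablySaturated (L : Type*) [LinearOrder L] : Prop :=
  ∀ A B : Set L, A.Countable → B.Countable → (∀ a ∈ A, ∀ b ∈ B, a < b) →
    ∃ y, (∀ a ∈ A, a < y) ∧ ∀ b ∈ B, y < b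

theorem IsMaximalPair.surjective [LinearOrder F] [Countable F] (hK : PolynomialIVT K)
    (hL : PolynomialIVT L) (hsat : CountablySaturated L)
    {i : F →+* K} {j : F →+* L} (hi : StrictMono i) (hj : StrictMono j)
    (hmax : IsMaximalPair i j) : Function.Surjective i := by
  intro x
  by_contra hxi
  obtain ⟨y, hy1, hy2⟩ := hsat (j '' {c | i c < x}) (j '' {c | x < i c})
    ((Set.to_countable _).image _) ((Set.to_countable _).image _) (by
      rintro _ ⟨c, hc, rfl⟩ _ ⟨d, hd, rfl⟩
      exact hj (hi.lt_iff_lt.1 (lt_trans hc hd)))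
  have hlt : ∀ c, i c < x → j c < y := fun c hc => hy1 _ ⟨c, hc, rfl⟩
  have hgt : ∀ c, x < i c → y < j c := fun c hc => hy2 _ ⟨c, hc, rfl⟩
  have hxy : SameCut i j x y := by
    refine ⟨hxi, ?_, fun c => ⟨hlt c, fun h => ?_⟩⟩
    · rintro ⟨c, rfl⟩
      rcases lt_trichotomy (i c) x with h | h | h
      · exact (hlt c h).false
      · exact hxi ⟨c, h⟩
      · exact (hgt c h).false
    · rcases lt_trichotomy (i c) x with h' | h' | h'
      · exact h'
      · exact absurd ⟨c, h'⟩ hxi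
      · exact absurd (hgt c h') h.not_gt
  obtain ⟨c, hc, -⟩ := hmax x y fun g => by
    obtain ⟨h1, h2⟩ := hmax.rootsInRange hK hL hi hj (g.natDegree + 1)
    exact pos_iff_of_sign_eq (hxy.sign_eval₂_eq hK hL hi hj h1 h2 g (Nat.lt_succ_self _))
  exact hxi ⟨c, hc⟩

/-- The projections of `G` to both factors induce the same ordering. -/
def OrderCompatible (G : Subring (K × L)) : Prop :=
  ∀ p ∈ G, 0 < p.1 ↔ 0 < p.2

theorem OrderCompatible.neg_iff {G : Subring (K × L)} (hG : OrderCompatible G) {p : K × L}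
    (hp : p ∈ G) : p.1 < 0 ↔ p.2 < 0 := by
  simpa using hG _ (neg_mem hp)

theorem OrderCompatible.eq_zero_iff {G : Subring (K × L)} (hG : OrderCompatible G) {p : K × L}
    (hp : p ∈ G) : p.1 = 0 ↔ p.2 = 0 := by
  have h1 := hG p hp
  have h2 := hG.neg_iff hp
  constructor <;> intro h
  · rw [h] at h1 h2
    exact le_antisymm (not_lt.1 fun h' => (h1.2 h').false) (not_lt.1 fun h' => (h2.2 h').false)
  · rw [h] at h1 h2
    exact le_antisymm (not_lt.1 fun h' => (h1.1 h').false) (not_lt.1 fun h' => (h2.1 h').false)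

theorem orderCompatible_bot : OrderCompatible (⊥ : Subring (K × L)) := by
  rintro p hp
  obtain ⟨n, rfl⟩ := Subring.mem_bot.1 hp
  simp

variable (K L) in
theorem exists_maximal_orderCompatible :
    ∃ G : Subring (K × L), Maximal OrderCompatible G := by
  obtain ⟨G, -, hG⟩ := zorn_le_nonempty₀ {G : Subring (K × L) | OrderCompatible G}
    (fun c hc hchain y hy => ⟨sSup c, fun p hp => by
      obtain ⟨G, hG, hp⟩ := (Subring.mem_sSup_of_directedOn ⟨y, hy⟩ hchain.directedOn).1 hp
      exact hc hG p hp, fun z hz => le_sSup hz⟩) ⊥ orderCompatible_bot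
  exact ⟨G, hG⟩

theorem inv_mem_of_maximal {G : Subring (K × L)} (hG : Maximal OrderCompatible G) {p : K × L}
    (hp : p ∈ G) (h0 : p.1 ≠ 0) : (p.1⁻¹, p.2⁻¹) ∈ G := by
  let H : Subring (K × L) :=
    { carrier := {x | ∃ b ∈ G, b.1 ≠ 0 ∧ b * x ∈ G}
      mul_mem' := by
        rintro x y ⟨b, hb, hb0, hx⟩ ⟨c, hc, hc0, hy⟩
        exact ⟨b * c, mul_mem hb hc, mul_ne_zero hb0 hc0, by
          rw [mul_mul_mul_comm]; exact mul_mem hx hy⟩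
      one_mem' := ⟨1, one_mem _, by simp, by simp⟩
      add_mem' := by
        rintro x y ⟨b, hb, hb0, hx⟩ ⟨c, hc, hc0, hy⟩
        refine ⟨b * c, mul_mem hb hc, mul_ne_zero hb0 hc0, ?_⟩
        have : b * c * (x + y) = c * (b * x) + b * (c * y) := by ring
        rw [this]
        exact add_mem (mul_mem hc hx) (mul_mem hb hy)
      zero_mem' := ⟨1, one_mem _, by simp, by simp⟩
      neg_mem' := by
        rintro x ⟨b, hb, hb0, hx⟩
        exact ⟨b, hb, hb0, by rw [mul_neg]; exact neg_mem hx⟩ }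
  have hH : OrderCompatible H := by
    rintro x ⟨b, hb, hb0, hx⟩
    have h1 := hG.prop _ (mul_mem hb hx)
    have hb1 : 0 < b.1 * b.1 := mul_self_pos.2 hb0
    have hb2 : 0 < b.2 * b.2 := mul_self_pos.2 (mt (hG.prop.eq_zero_iff hb).2 hb0)
    simpa only [Prod.fst_mul, Prod.snd_mul, ← mul_assoc, mul_pos_iff_of_pos_left hb1,
      mul_pos_iff_of_pos_left hb2] using h1
  refine hG.le_of_ge hH (fun x hx => ⟨1, one_mem _, by simp, by simpa using hx⟩) ?_
  refine ⟨p, hp, h0, ?_⟩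
  convert! one_mem G
  ext <;> simp [h0, mt (hG.prop.eq_zero_iff hp).2 h0]

theorem exists_isMaximalPair {K : Type u} {L : Type v} [Field K] [LinearOrder K]
    [IsStrictOrderedRing K] [Field L] [LinearOrder L] [IsStrictOrderedRing L] :
    ∃ (F : Type (max u v)) (_ : Field F) (_ : LinearOrder F) (i : F →+* K) (j : F →+* L),
      StrictMono i ∧ StrictMono j ∧ IsMaximalPair i j := by
  obtain ⟨G, hG⟩ := exists_maximal_orderCompatible K L
  let i₀ : G →+* K := (RingHom.fst K L).comp G.subtype
  let j₀ : G →+* L := (RingHom.snd K L).comp G.subtype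
  have hi₀ : Function.Injective i₀ := by
    rw [injective_iff_map_eq_zero]
    intro p hp
    exact Subtype.ext (Prod.ext hp ((hG.prop.eq_zero_iff p.2).1 hp))
  have hfield : IsField G :=
    { exists_pair_ne := ⟨0, 1, zero_ne_one⟩
      mul_comm := mul_comm
      mul_inv_cancel := by
        intro p hp
        have h0 : p.1.1 ≠ 0 := fun h => hp (hi₀ (by simpa [i₀] using h))
        refine ⟨⟨_, inv_mem_of_maximal hG p.2 h0⟩, ?_⟩
        apply hi₀
        simp [i₀, h0] }
  let _ : Field G := hfield.toField
  let _ : LinearOrder G := LinearOrder.lift' i₀ hi₀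
  refine ⟨G, inferInstance, inferInstance, i₀, j₀, fun p q h => h, fun p q h => ?_,
    fun x y hxy => ?_⟩
  · have h1 : i₀ p < i₀ q := h
    have := (hG.prop _ (sub_mem q.2 p.2)).1 (sub_pos.2 h1)
    exact sub_pos.1 this
  · let H : Subring (K × L) := (eval₂RingHom G.subtype (x, y)).range
    have h1 : ∀ g : G[X], (g.eval₂ G.subtype (x, y)).1 = g.eval₂ i₀ x := fun g =>
      hom_eval₂ g G.subtype (RingHom.fst K L) (x, y)
    have h2 : ∀ g : G[X], (g.eval₂ G.subtype (x, y)).2 = g.eval₂ j₀ y := fun g =>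
      hom_eval₂ g G.subtype (RingHom.snd K L) (x, y)
    have hH : OrderCompatible H := by
      rintro _ ⟨g, rfl⟩
      rw [coe_eval₂RingHom, h1, h2]
      exact hxy g
    have hle := hG.le_of_ge hH fun p hp => ⟨C ⟨p, hp⟩, by simp⟩
    exact ⟨⟨(x, y), hle ⟨X, by simp⟩⟩, rfl, rfl⟩

theorem exists_strictMono_ringHom {K : Type u} {L : Type v} [Field K] [LinearOrder K]
    [IsStrictOrderedRing K] [Field L] [LinearOrder L] [IsStrictOrderedRing L] [Countable K]
    (hK : PolynomialIVT K)
    (hL : PolynomialIVT L) (hsat : CountablySaturated L) : ∃ φ : K →+* L, StrictMono φ := by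
  obtain ⟨F, _, _, i, j, hi, hj, hmax⟩ := exists_isMaximalPair (K := K) (L := L)
  have : Countable F := hi.injective.countable
  let e := RingEquiv.ofBijective i ⟨hi.injective, hmax.surjective hK hL hsat hi hj⟩
  refine ⟨j.comp e.symm.toRingHom, fun x y hxy => hj ?_⟩
  obtain ⟨a, rfl⟩ := e.surjective x
  obtain ⟨b, rfl⟩ := e.surjective y
  simpa using hi.lt_iff_lt.1 hxy

end BackAndForth

section Ultrapower

open Filter

theorem PolynomialIVT.germ {k : Type*} [Field k] [LinearOrder k] (hk : PolynomialIVT k)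
    (φ : Ultrafilter ℕ) :
    PolynomialIVT ((φ : Filter ℕ).Germ k) := by
  intro f a b hab hneg
  obtain ⟨a, rfl⟩ := Quotient.exists_rep a
  obtain ⟨b, rfl⟩ := Quotient.exists_rep b
  obtain ⟨F, rfl⟩ := Polynomial.map_surjective (Germ.coeRingHom (R := k) (φ : Filter ℕ))
    Quotient.mk_surjective f
  have hev : ∀ c : ℕ → k, (F.map (Germ.coeRingHom (φ : Filter ℕ))).eval (c : (φ : Filter ℕ).Germ k)
      = ((fun n => (F.map (Pi.evalRingHom _ n)).eval (c n) : ℕ → k) : (φ : Filter ℕ).Germ k) := by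
    intro c
    have h1 : (fun n => (F.map (Pi.evalRingHom _ n)).eval (c n) : ℕ → k) = F.eval c := by
      ext n
      rw [eval_map]
      exact eval₂_hom (Pi.evalRingHom (fun _ : ℕ => k) n) c
    rw [h1, eval_map]
    exact eval₂_hom (Germ.coeRingHom (R := k) (φ : Filter ℕ)) c
  have hab' : ∀ᶠ n in φ, a n < b n := Germ.coe_lt.1 hab
  have hneg' : ∀ᶠ n in φ, (F.map (Pi.evalRingHom _ n)).eval (a n) *
      (F.map (Pi.evalRingHom _ n)).eval (b n) < 0 := by
    have h1 := hev a
    have h2 := hev b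
    change eval _ _ * eval _ _ < _ at hneg
    erw [h1, h2, ← Germ.coe_mul, ← Germ.coe_zero, Germ.coe_lt] at hneg
    exact hneg
  have hc : ∀ n, ∃ c, a n < b n → (F.map (Pi.evalRingHom _ n)).eval (a n) *
      (F.map (Pi.evalRingHom _ n)).eval (b n) < 0 →
      a n < c ∧ c < b n ∧ (F.map (Pi.evalRingHom _ n)).eval c = 0 := by
    intro n
    by_cases h : a n < b n ∧ (F.map (Pi.evalRingHom _ n)).eval (a n) *
      (F.map (Pi.evalRingHom _ n)).eval (b n) < 0
    · obtain ⟨c, hc⟩ := hk _ _ _ h.1 h.2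
      exact ⟨c, fun _ _ => hc⟩
    · exact ⟨0, fun h1 h2 => absurd ⟨h1, h2⟩ h⟩
  choose c hc using hc
  refine ⟨(c : (φ : Filter ℕ).Germ k), Germ.coe_lt.2 ?_, Germ.coe_lt.2 ?_, ?_⟩
  · filter_upwards [hab', hneg'] with n h1 h2 using (hc n h1 h2).1
  · filter_upwards [hab', hneg'] with n h1 h2 using (hc n h1 h2).2.1
  · rw [hev, ← Germ.coe_zero, Germ.coe_eq]
    filter_upwards [hab', hneg'] with n h1 h2 using (hc n h1 h2).2.2

theorem countablySaturated_germ {k : Type*} [LinearOrder k] [DenselyOrdered k] [NoMinOrder k]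
    [NoMaxOrder k] [Nonempty k] :
    CountablySaturated ((hyperfilter ℕ : Filter ℕ).Germ k) := by
  intro A B hA hB hAB
  obtain ⟨eA, heA⟩ := Set.countable_iff_exists_injOn.1 hA
  obtain ⟨eB, heB⟩ := Set.countable_iff_exists_injOn.1 hB
  have hfA : ∀ m, {a ∈ A | eA a ≤ m}.Finite := fun m => Set.Finite.of_finite_image
    ((Set.finite_Iic m).subset (by rintro _ ⟨a, ha, rfl⟩; exact ha.2))
    (heA.mono fun a ha => ha.1)
  have hfB : ∀ m, {b ∈ B | eB b ≤ m}.Finite := fun m => Set.Finite.of_finite_image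
    ((Set.finite_Iic m).subset (by rintro _ ⟨a, ha, rfl⟩; exact ha.2))
    (heB.mono fun a ha => ha.1)
  choose rep hrep using
    (Quotient.exists_rep : ∀ a : (hyperfilter ℕ : Filter ℕ).Germ k, ∃ f : ℕ → k, _)
  have hrep' : ∀ a, (rep a : (hyperfilter ℕ : Filter ℕ).Germ k) = a := hrep
  let good : ℕ → ℕ → Prop := fun n m =>
    ∀ a ∈ {a ∈ A | eA a ≤ m}, ∀ b ∈ {b ∈ B | eB b ≤ m}, rep a n < rep b n
  have hgood : ∀ m, ∀ᶠ n in (hyperfilter ℕ : Filter ℕ), good n m := by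
    intro m
    refine (eventually_all_finite (hfA m)).2 fun a ha =>
      (eventually_all_finite (hfB m)).2 fun b hb => ?_
    have := hAB a ha.1 b hb.1
    rw [← hrep' a, ← hrep' b] at this
    exact Germ.coe_lt.1 this
  have hy : ∀ n, ∃ y, ∀ m ≤ n, good n m →
      (∀ a ∈ {a ∈ A | eA a ≤ m}, rep a n < y) ∧ ∀ b ∈ {b ∈ B | eB b ≤ m}, y < rep b n := by
    intro n
    have hfin : {m | m ≤ n ∧ good n m}.Finite := (Set.finite_Iic n).subset fun m hm => hm.1
    have hlo : (⋃ m ∈ {m | m ≤ n ∧ good n m},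
        (fun a => rep a n) '' {a ∈ A | eA a ≤ m}).Finite :=
      hfin.biUnion fun m _ => (hfA m).image _
    have hup : (⋃ m ∈ {m | m ≤ n ∧ good n m},
        (fun b => rep b n) '' {b ∈ B | eB b ≤ m}).Finite :=
      hfin.biUnion fun m _ => (hfB m).image _
    obtain ⟨y, h1, h2⟩ := Order.exists_between_finsets hlo.toFinset hup.toFinset (by
      intro x hx y hy
      obtain ⟨m, ⟨-, hm⟩, a, ha, rfl⟩ := Set.mem_iUnion₂.1 (hlo.mem_toFinset.1 hx)
      obtain ⟨l, ⟨-, hl⟩, b, hb, rfl⟩ := Set.mem_iUnion₂.1 (hup.mem_toFinset.1 hy)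
      rcases le_total m l with h | h
      · exact hl a ⟨ha.1, ha.2.trans h⟩ b hb
      · exact hm a ha b ⟨hb.1, hb.2.trans h⟩)
    exact ⟨y, fun m hm hg =>
      ⟨fun a ha => h1 _ (hlo.mem_toFinset.2 (Set.mem_iUnion₂.2 ⟨m, ⟨hm, hg⟩, a, ha, rfl⟩)),
        fun b hb => h2 _ (hup.mem_toFinset.2 (Set.mem_iUnion₂.2 ⟨m, ⟨hm, hg⟩, b, hb, rfl⟩))⟩⟩
  choose y hy using hy
  have hlarge : ∀ m, ∀ᶠ n in (hyperfilter ℕ : Filter ℕ), m ≤ n := fun m =>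
    Nat.hyperfilter_le_atTop (eventually_ge_atTop m)
  refine ⟨(y : (hyperfilter ℕ : Filter ℕ).Germ k), fun a ha => ?_, fun b hb => ?_⟩
  · rw [← hrep' a, Germ.coe_lt]
    filter_upwards [hgood (eA a), hlarge (eA a)] with n h1 h2
    exact (hy n _ h2 h1).1 a ⟨ha, le_rfl⟩
  · rw [← hrep' b, Germ.coe_lt]
    filter_upwards [hgood (eB b), hlarge (eB b)] with n h1 h2
    exact (hy n _ h2 h1).2 b ⟨hb, le_rfl⟩

theorem polynomialIVT_algebraicClosure_rat : PolynomialIVT (algebraicClosure ℚ ℝ) := by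
  intro f a b hab hneg
  have hev : ∀ c : algebraicClosure ℚ ℝ, ((f.eval c : algebraicClosure ℚ ℝ) : ℝ) =
      aeval (c : ℝ) f := fun c => (aeval_algebraMap_apply_eq_algebraMap_eval c f).symm
  have f0 : f ≠ 0 := by rintro rfl; simp at hneg
  have hneg' : aeval (a : ℝ) f * aeval (b : ℝ) f < 0 := by
    rw [← hev, ← hev]; exact_mod_cast hneg
  have hcont : ContinuousOn (fun x : ℝ => aeval x f) (Set.Icc a b) :=
    (Polynomial.continuous_aeval f).continuousOn
  have hab' : (a : ℝ) ≤ b := hab.le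
  have : ∃ c ∈ Set.Ioo (a : ℝ) b, aeval c f = 0 := by
    rcases mul_neg_iff.1 hneg' with ⟨h1, h2⟩ | ⟨h1, h2⟩
    · exact intermediate_value_Ioo' hab' hcont ⟨h2, h1⟩
    · exact intermediate_value_Ioo hab' hcont ⟨h1, h2⟩
  obtain ⟨c, hc, hc0⟩ := this
  have : Algebra.IsAlgebraic ℚ (algebraicClosure ℚ ℝ) := by
    convert! algebraicClosure.isAlgebraic ℚ ℝ
  have hcalg : c ∈ algebraicClosure ℚ ℝ := mem_algebraicClosure_iff.2 <|
    IsAlgebraic.restrictScalars (A := ℝ) ℚ (S := algebraicClosure ℚ ℝ) ⟨f, f0, hc0⟩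
  refine ⟨⟨c, hcalg⟩, hc.1, hc.2, ?_⟩
  have := hev ⟨c, hcalg⟩
  rw [hc0] at this
  exact_mod_cast this

end Ultrapower

section DifferenceRing

/-- Formal differences of elements of a cancellative commutative semiring. -/
def differenceSetoid (S : Type*) [CommSemiring S] [IsCancelAdd S] : Setoid (S × S) where
  r p q := p.1 + q.2 = q.1 + p.2
  iseqv :=
    { refl := fun _ => rfl
      symm := fun h => h.symm
      trans := fun {p q r} h₁ h₂ => by
        apply add_right_cancel (b := q.2)
        calc p.1 + r.2 + q.2 = p.1 + q.2 + r.2 := by ring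
          _ = q.1 + r.2 + p.2 := by rw [h₁]; ring
          _ = r.1 + p.2 + q.2 := by rw [h₂]; ring }

/-- The ring of differences of a cancellative commutative semiring. -/
def DifferenceRing (S : Type*) [CommSemiring S] [IsCancelAdd S] : Type _ :=
  Quotient (differenceSetoid S)

namespace DifferenceRing

variable {S : Type*} [CommSemiring S] [IsCancelAdd S]

/-- The difference `a - b`. -/
def mk (a b : S) : DifferenceRing S := Quotient.mk (differenceSetoid S) (a, b)

theorem mk_eq_mk {a b c d : S} : mk a b = mk c d ↔ a + d = c + b := Quotient.eq

theorem exists_mk (x : DifferenceRing S) : ∃ a b, mk a b = x := by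
  induction x using Quotient.ind with
  | _ p => exact ⟨p.1, p.2, rfl⟩

instance : Zero (DifferenceRing S) := ⟨mk 0 0⟩

instance : One (DifferenceRing S) := ⟨mk 1 0⟩

instance : Add (DifferenceRing S) where
  add := Quotient.map₂ (fun p q => (p.1 + q.1, p.2 + q.2)) fun p p' hp q q' hq => by
    change p.1 + q.1 + (p'.2 + q'.2) = p'.1 + q'.1 + (p.2 + q.2)
    rw [add_add_add_comm, show p.1 + p'.2 = p'.1 + p.2 from hp,
      show q.1 + q'.2 = q'.1 + q.2 from hq, add_add_add_comm]

instance : Neg (DifferenceRing S) where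
  neg := Quotient.map (fun p => (p.2, p.1)) fun p q h => by
    change p.2 + q.1 = q.2 + p.1
    rw [add_comm, add_comm q.2]
    exact h.symm

instance : Mul (DifferenceRing S) where
  mul := Quotient.map₂ (fun p q => (p.1 * q.1 + p.2 * q.2, p.1 * q.2 + p.2 * q.1))
    fun p p' hp q q' hq => by
      have hp : p.1 + p'.2 = p'.1 + p.2 := hp
      have hq : q.1 + q'.2 = q'.1 + q.2 := hq
      change p.1 * q.1 + p.2 * q.2 + (p'.1 * q'.2 + p'.2 * q'.1) =
        p'.1 * q'.1 + p'.2 * q'.2 + (p.1 * q.2 + p.2 * q.1)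
      apply add_right_cancel (b := p'.2 * q.1 + p'.1 * q.2)
      calc _ = (p.1 + p'.2) * q.1 + (p'.1 + p.2) * q.2 + (p'.1 * q'.2 + p'.2 * q'.1) := by ring
        _ = (p'.1 + p.2) * q.1 + (p.1 + p'.2) * q.2 + (p'.1 * q'.2 + p'.2 * q'.1) := by rw [hp]
        _ = p'.1 * (q.1 + q'.2) + p'.2 * (q'.1 + q.2) + (p.1 * q.2 + p.2 * q.1) := by ring
        _ = p'.1 * (q'.1 + q.2) + p'.2 * (q.1 + q'.2) + (p.1 * q.2 + p.2 * q.1) := by rw [hq]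
        _ = _ := by ring

theorem mk_add_mk (a b c d : S) : mk a b + mk c d = mk (a + c) (b + d) := rfl

theorem mk_mul_mk (a b c d : S) : mk a b * mk c d = mk (a * c + b * d) (a * d + b * c) := rfl

theorem neg_mk (a b : S) : -mk a b = mk b a := rfl

theorem zero_def : (0 : DifferenceRing S) = mk 0 0 := rfl

theorem one_def : (1 : DifferenceRing S) = mk 1 0 := rfl

instance : CommRing (DifferenceRing S) where
  add_assoc x y z := by
    obtain ⟨a, b, rfl⟩ := exists_mk x
    obtain ⟨c, d, rfl⟩ := exists_mk y
    obtain ⟨e, f, rfl⟩ := exists_mk z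
    simp only [mk_add_mk, add_assoc]
  add_comm x y := by
    obtain ⟨a, b, rfl⟩ := exists_mk x
    obtain ⟨c, d, rfl⟩ := exists_mk y
    simp only [mk_add_mk, add_comm]
  zero_add x := by
    obtain ⟨a, b, rfl⟩ := exists_mk x
    simp only [zero_def, mk_add_mk, zero_add]
  add_zero x := by
    obtain ⟨a, b, rfl⟩ := exists_mk x
    simp only [zero_def, mk_add_mk, add_zero]
  neg_add_cancel x := by
    obtain ⟨a, b, rfl⟩ := exists_mk x
    rw [neg_mk, mk_add_mk, zero_def, mk_eq_mk]
    ring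
  mul_assoc x y z := by
    obtain ⟨a, b, rfl⟩ := exists_mk x
    obtain ⟨c, d, rfl⟩ := exists_mk y
    obtain ⟨e, f, rfl⟩ := exists_mk z
    rw [mk_mul_mk, mk_mul_mk, mk_mul_mk, mk_mul_mk, mk_eq_mk]
    ring
  mul_comm x y := by
    obtain ⟨a, b, rfl⟩ := exists_mk x
    obtain ⟨c, d, rfl⟩ := exists_mk y
    rw [mk_mul_mk, mk_mul_mk, mk_eq_mk]
    ring
  one_mul x := by
    obtain ⟨a, b, rfl⟩ := exists_mk x
    rw [one_def, mk_mul_mk, mk_eq_mk]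
    ring
  mul_one x := by
    obtain ⟨a, b, rfl⟩ := exists_mk x
    rw [one_def, mk_mul_mk, mk_eq_mk]
    ring
  zero_mul x := by
    obtain ⟨a, b, rfl⟩ := exists_mk x
    rw [zero_def, mk_mul_mk, mk_eq_mk]
    ring
  mul_zero x := by
    obtain ⟨a, b, rfl⟩ := exists_mk x
    rw [zero_def, mk_mul_mk, mk_eq_mk]
    ring
  left_distrib x y z := by
    obtain ⟨a, b, rfl⟩ := exists_mk x
    obtain ⟨c, d, rfl⟩ := exists_mk y
    obtain ⟨e, f, rfl⟩ := exists_mk z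
    simp only [mk_mul_mk, mk_add_mk, mk_eq_mk]
    ring
  right_distrib x y z := by
    obtain ⟨a, b, rfl⟩ := exists_mk x
    obtain ⟨c, d, rfl⟩ := exists_mk y
    obtain ⟨e, f, rfl⟩ := exists_mk z
    simp only [mk_mul_mk, mk_add_mk, mk_eq_mk]
    ring
  nsmul := nsmulRec
  zsmul := zsmulRec

/-- The canonical map to the ring of differences. -/
def of : S →+* DifferenceRing S where
  toFun a := mk a 0
  map_one' := rfl
  map_zero' := rfl
  map_mul' a b := by simp [mk_mul_mk]
  map_add' a b := by simp [mk_add_mk]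

theorem of_injective : Function.Injective (of : S → DifferenceRing S) := fun a b h => by
  simpa using mk_eq_mk.1 h

instance [Countable S] : Countable (DifferenceRing S) :=
  inferInstanceAs (Countable (Quotient (differenceSetoid S)))

theorem exists_of (hS : ∀ x y : S, ∃ z, x + z = y ∨ y + z = x) (x : DifferenceRing S) :
    ∃ a, x = of a ∨ x = -of a := by
  obtain ⟨a, b, rfl⟩ := exists_mk x
  obtain ⟨c, h | h⟩ := hS a b
  · exact ⟨c, .inr (mk_eq_mk.2 (by simpa using h))⟩
  · exact ⟨c, .inl (mk_eq_mk.2 (by simpa [add_comm] using h.symm))⟩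

theorem noZeroDivisors [NoZeroDivisors S] (hS : ∀ x y : S, ∃ z, x + z = y ∨ y + z = x) :
    NoZeroDivisors (DifferenceRing S) where
  eq_zero_or_eq_zero_of_mul_eq_zero {x y} h := by
    have key : ∀ a b : S, of a * of b = 0 → of a = 0 ∨ of b = 0 := by
      intro a b hab
      rw [← map_mul, map_eq_zero_iff _ of_injective, mul_eq_zero] at hab
      rcases hab with rfl | rfl <;> simp
    obtain ⟨a, rfl | rfl⟩ := exists_of hS x <;> obtain ⟨b, rfl | rfl⟩ := exists_of hS y <;>
      simpa using key a b (by simpa using h)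

end DifferenceRing

theorem exists_isAlgClosed_of_noZeroDivisors (S : Type u) [CommSemiring S] [IsCancelAdd S]
    [NoZeroDivisors S] [Nontrivial S] [Countable S]
    (hS : ∀ x y : S, ∃ z, x + z = y ∨ y + z = x) :
    ∃ (Ω : Type u) (_ : Field Ω) (_ : IsAlgClosed Ω) (_ : Countable Ω) (e : S →+* Ω),
      Function.Injective e := by
  have := DifferenceRing.noZeroDivisors hS
  have : Nontrivial (DifferenceRing S) := DifferenceRing.of_injective.nontrivial
  have : IsDomain (DifferenceRing S) := NoZeroDivisors.to_isDomain _
  have : Countable (FractionRing (DifferenceRing S)) :=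
    (IsLocalization.mk'_surjective (nonZeroDivisors (DifferenceRing S))).countable
  have : Countable (AlgebraicClosure (FractionRing (DifferenceRing S))) := by
    rw [← Cardinal.mk_le_aleph0_iff]
    refine (Algebra.IsAlgebraic.cardinalMk_le_max (FractionRing (DifferenceRing S)) _).trans ?_
    simp
  have h₁ : Function.Injective (algebraMap (FractionRing (DifferenceRing S))
      (AlgebraicClosure (FractionRing (DifferenceRing S)))) := RingHom.injective _
  have h₂ : Function.Injective (algebraMap (DifferenceRing S) (FractionRing (DifferenceRing S))) :=
    IsFractionRing.injective _ _
  exact ⟨AlgebraicClosure (FractionRing (DifferenceRing S)), inferInstance, inferInstance, this,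
    (algebraMap (FractionRing (DifferenceRing S)) _).comp
      ((algebraMap (DifferenceRing S) (FractionRing (DifferenceRing S))).comp DifferenceRing.of),
    h₁.comp (h₂.comp DifferenceRing.of_injective)⟩

end DifferenceRing

section RealClosure

/-- A subsemiring of a field that is the nonnegative cone of an ordered ring. -/
structure IsTotalCone {R : Type*} [CommRing R] (P : Subsemiring R) : Prop where
  eq_zero_of_neg_mem : ∀ x ∈ P, -x ∈ P → x = 0
  sub_mem_or : ∀ x ∈ P, ∀ y ∈ P, x - y ∈ P ∨ y - x ∈ P

theorem IsTotalCone.exists_le_maximal {R : Type*} [CommRing R] {P : Subsemiring R}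
    (hP : IsTotalCone P) : ∃ Q, P ≤ Q ∧ Maximal IsTotalCone Q := by
  refine zorn_le_nonempty₀ {Q | IsTotalCone Q} (fun c hc hchain Q hQ => ?_) P hP
  have hmem : ∀ x, x ∈ sSup c ↔ ∃ S ∈ c, x ∈ S := fun x =>
    Subsemiring.mem_sSup_of_directedOn ⟨Q, hQ⟩ hchain.directedOn
  refine ⟨sSup c, ⟨fun x hx hx' => ?_, fun x hx y hy => ?_⟩, fun _ => le_sSup⟩
  · obtain ⟨S, hS, hxS⟩ := (hmem _).1 hx
    obtain ⟨T, hT, hxT⟩ := (hmem _).1 hx'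
    rcases hchain.total hS hT with h | h
    · exact (hc hT).eq_zero_of_neg_mem x (h hxS) hxT
    · exact (hc hS).eq_zero_of_neg_mem x hxS (h hxT)
  · obtain ⟨S, hS, hxS⟩ := (hmem _).1 hx
    obtain ⟨T, hT, hyT⟩ := (hmem _).1 hy
    simp only [hmem]
    rcases hchain.total hS hT with h | h
    · exact ((hc hT).sub_mem_or x (h hxS) y hyT).imp (fun h => ⟨T, hT, h⟩) fun h => ⟨T, hT, h⟩
    · exact ((hc hS).sub_mem_or x hxS y (h hyT)).imp (fun h => ⟨S, hS, h⟩) fun h => ⟨S, hS, h⟩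

section TotalCone

variable {Ω : Type*} [Field Ω] {P : Subsemiring Ω}

theorem IsTotalCone.mem_of_mul_mem (hP : Maximal IsTotalCone P) {b x : Ω} (hb : b ∈ P)
    (hb0 : b ≠ 0) (hx : b * x ∈ P) : x ∈ P := by
  let Q : Subsemiring Ω :=
    { carrier := {x | ∃ b ∈ P, b ≠ 0 ∧ b * x ∈ P}
      mul_mem' := by
        rintro x y ⟨b, hb, hb0, hbx⟩ ⟨c, hc, hc0, hcy⟩
        refine ⟨b * c, mul_mem hb hc, mul_ne_zero hb0 hc0, ?_⟩
        convert mul_mem hbx hcy using 1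
        ring
      one_mem' := ⟨1, one_mem P, one_ne_zero, by simp⟩
      add_mem' := by
        rintro x y ⟨b, hb, hb0, hbx⟩ ⟨c, hc, hc0, hcy⟩
        refine ⟨b * c, mul_mem hb hc, mul_ne_zero hb0 hc0, ?_⟩
        convert add_mem (mul_mem hc hbx) (mul_mem hb hcy) using 1
        ring
      zero_mem' := ⟨1, one_mem P, one_ne_zero, by simp⟩ }
  have hPQ : P ≤ Q := fun x hx => ⟨1, one_mem P, one_ne_zero, by simpa⟩
  have hQ : IsTotalCone Q := by
    constructor
    · rintro x ⟨b, hb, hb0, hbx⟩ ⟨c, hc, hc0, hcx⟩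
      have : b * c * x = 0 := hP.prop.eq_zero_of_neg_mem _
        (by convert mul_mem hc hbx using 1; ring) (by convert mul_mem hb hcx using 1; ring)
      simpa [hb0, hc0] using this
    · rintro x ⟨b, hb, hb0, hbx⟩ y ⟨c, hc, hc0, hcy⟩
      refine (hP.prop.sub_mem_or _ (mul_mem hc hbx) _ (mul_mem hb hcy)).imp (fun h => ?_)
        fun h => ?_
      all_goals
        refine ⟨b * c, mul_mem hb hc, mul_ne_zero hb0 hc0, ?_⟩
        convert h using 1
        ring
  exact hP.le_of_ge hQ hPQ ⟨b, hb, hb0, hx⟩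

/-- The subfield of differences of elements of a maximal total cone. -/
def totalConeSubfield (P : Subsemiring Ω) (hP : Maximal IsTotalCone P) : Subfield Ω where
  carrier := {x | x ∈ P ∨ -x ∈ P}
  mul_mem' := by
    rintro x y (hx | hx) (hy | hy)
    · exact .inl (mul_mem hx hy)
    · exact .inr (by simpa using mul_mem hx hy)
    · exact .inr (by simpa using mul_mem hx hy)
    · exact .inl (by simpa using mul_mem hx hy)
  one_mem' := .inl (one_mem P)
  add_mem' := by
    rintro x y (hx | hx) (hy | hy)
    · exact .inl (add_mem hx hy)
    · simpa [sub_eq_add_neg, add_comm] using hP.prop.sub_mem_or x hx (-y) hy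
    · simpa [sub_eq_add_neg, add_comm] using hP.prop.sub_mem_or y hy (-x) hx
    · exact .inr (by simpa [add_comm] using add_mem hx hy)
  zero_mem' := .inl (zero_mem P)
  neg_mem' := by
    rintro x (hx | hx)
    · exact .inr (by simpa using hx)
    · exact .inl hx
  inv_mem' := by
    rintro x hx
    by_cases hx0 : x = 0
    · simp [hx0]
    rcases hx with hx | hx
    · exact .inl (IsTotalCone.mem_of_mul_mem hP hx hx0 (by simp [hx0]))
    · exact .inr (IsTotalCone.mem_of_mul_mem hP hx (neg_ne_zero.2 hx0) (by simp [hx0]))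

open Classical in
/-- The order whose nonnegative cone is the given maximal total cone. -/
@[reducible]
noncomputable def totalConeOrder (hP : Maximal IsTotalCone P) :
    LinearOrder (totalConeSubfield P hP) where
  le x y := (y - x : Ω) ∈ P
  le_refl x := by simp
  le_trans x y z hxy hyz := by simpa using add_mem hyz hxy
  le_antisymm x y hxy hyx := Subtype.ext <| Eq.symm <| sub_eq_zero.1 <|
    hP.prop.eq_zero_of_neg_mem _ hxy (by simpa using hyx)
  le_total x y := by
    have h : (y - x : Ω) ∈ P ∨ -(y - x : Ω) ∈ P := (y - x).2
    simpa using h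
  toDecidableLE := Classical.decRel _

theorem totalConeOrder_isStrictOrderedRing (hP : Maximal IsTotalCone P) :
    @IsStrictOrderedRing (totalConeSubfield P hP) _ (totalConeOrder hP).toPartialOrder := by
  let _ := totalConeOrder hP
  have hle : ∀ x y : totalConeSubfield P hP, x ≤ y ↔ (y - x : Ω) ∈ P := fun _ _ => Iff.rfl
  have : IsOrderedAddMonoid (totalConeSubfield P hP) :=
    { add_le_add_left := fun x y h z => by simpa [hle] using h }
  have : ZeroLEOneClass (totalConeSubfield P hP) := ⟨by simp [hle]⟩
  refine IsStrictOrderedRing.of_mul_pos fun x y hx hy => lt_of_le_of_ne ?_ ?_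
  · simpa [hle] using mul_mem ((hle _ _).1 hx.le) ((hle _ _).1 hy.le)
  · exact (mul_ne_zero hx.ne' hy.ne').symm

end TotalCone

theorem exists_maximal_orderedField {Ω : Type u} [Field Ω] [IsAlgClosed Ω] [Countable Ω]
    {P₀ : Subsemiring Ω} (hP₀ : IsTotalCone P₀) :
    ∃ (K : Type u) (_ : Field K) (_ : LinearOrder K) (_ : IsStrictOrderedRing K)
      (_ : Countable K) (e : K →+* Ω), (∀ x ∈ P₀, ∃ y, 0 ≤ y ∧ e y = x) ∧
      ∀ f : K[X], Irreducible f → ∀ O : Subsemiring (AdjoinRoot f), IsTotalCone O →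
        (∀ x, x ∈ O ∨ -x ∈ O) → (∀ c, 0 ≤ c → AdjoinRoot.of f c ∈ O) → f.natDegree ≤ 1 := by
  obtain ⟨P, hP₀P, hP⟩ := hP₀.exists_le_maximal
  let _ := totalConeOrder hP
  have hle : ∀ x : totalConeSubfield P hP, 0 ≤ x ↔ (x : Ω) ∈ P := fun x => by
    change (x - (0 : totalConeSubfield P hP) : Ω) ∈ P ↔ _
    simp
  refine ⟨totalConeSubfield P hP, inferInstance, totalConeOrder hP,
    totalConeOrder_isStrictOrderedRing hP, inferInstance, (totalConeSubfield P hP).subtype,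
    fun x hx => ⟨⟨x, .inl (hP₀P hx)⟩, (hle _).2 (hP₀P hx), rfl⟩, fun f hf O hO htot hof => ?_⟩
  obtain ⟨α, hα⟩ := IsAlgClosed.exists_eval₂_eq_zero (totalConeSubfield P hP).subtype f
    hf.degree_pos.ne'
  have := Fact.mk hf
  let ψ := AdjoinRoot.lift (totalConeSubfield P hP).subtype α hα
  have hψ : Function.Injective ψ := ψ.injective
  have hcone : IsTotalCone (O.map ψ) := by
    constructor
    · rintro _ ⟨x, hx, rfl⟩ ⟨y, hy, hxy⟩
      rw [← map_neg] at hxy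
      rw [hO.eq_zero_of_neg_mem x hx (hψ hxy ▸ hy), map_zero]
    · rintro _ ⟨x, hx, rfl⟩ _ ⟨y, hy, rfl⟩
      rw [← map_sub, ← map_sub]
      exact (hO.sub_mem_or x hx y hy).imp (fun h => ⟨_, h, rfl⟩) fun h => ⟨_, h, rfl⟩
  have hPO : P ≤ O.map ψ := fun x hx =>
    ⟨_, hof ⟨x, .inl hx⟩ ((hle _).2 hx), by simp [ψ]⟩
  have hOP : O.map ψ ≤ P := hP.le_of_ge hcone hPO
  have hαP : α ∈ totalConeSubfield P hP := by
    have hroot : ψ (AdjoinRoot.root f) = α := by simp [ψ]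
    refine (htot (AdjoinRoot.root f)).imp (fun h => hOP ⟨_, h, hroot⟩) fun h =>
      hOP ⟨_, h, by rw [map_neg, hroot]⟩
  have hdeg := degree_eq_one_of_irreducible_of_root hf (x := ⟨α, hαP⟩) <| by
    apply (totalConeSubfield P hP).subtype.injective
    rw [map_zero, ← hα]
    exact (eval₂_at_apply (totalConeSubfield P hP).subtype ⟨α, hαP⟩).symm
  exact (natDegree_eq_of_degree_eq_some hdeg).le

theorem exists_isTotalCone_of_neg_one_notMem {E : Type*} [Field E] {T₀ : Subsemiring E}
    (hsq : ∀ x, x ^ 2 ∈ T₀) (hneg : -1 ∉ T₀) :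
    ∃ O, T₀ ≤ O ∧ IsTotalCone O ∧ ∀ x, x ∈ O ∨ -x ∈ O := by
  obtain ⟨O, hO₀, hO⟩ : ∃ O, T₀ ≤ O ∧ Maximal (fun T : Subsemiring E => -1 ∉ T) O := by
    refine zorn_le_nonempty₀ {T : Subsemiring E | -1 ∉ T} (fun c hc hchain Q hQ => ?_) T₀ hneg
    refine ⟨sSup c, fun h => ?_, fun _ => le_sSup⟩
    obtain ⟨S, hS, hmem⟩ :=
      (Subsemiring.mem_sSup_of_directedOn ⟨Q, hQ⟩ hchain.directedOn).1 h
    exact hc hS hmem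
  have htot : ∀ x, x ∈ O ∨ -x ∈ O := by
    intro a
    by_contra! ha
    let Q : Subsemiring E :=
      { carrier := {x | ∃ s ∈ O, ∃ t ∈ O, x = s - a * t}
        mul_mem' := by
          rintro _ _ ⟨s, hs, t, ht, rfl⟩ ⟨s', hs', t', ht', rfl⟩
          exact ⟨s * s' + a ^ 2 * (t * t'),
            add_mem (mul_mem hs hs') (mul_mem (hO₀ (hsq a)) (mul_mem ht ht')),
            s * t' + t * s', add_mem (mul_mem hs ht') (mul_mem ht hs'), by ring⟩
        one_mem' := ⟨1, one_mem O, 0, zero_mem O, by simp⟩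
        add_mem' := by
          rintro _ _ ⟨s, hs, t, ht, rfl⟩ ⟨s', hs', t', ht', rfl⟩
          exact ⟨s + s', add_mem hs hs', t + t', add_mem ht ht', by ring⟩
        zero_mem' := ⟨0, zero_mem O, 0, zero_mem O, by simp⟩ }
    have hQ : -1 ∈ Q := by
      by_contra hQ
      have hOQ : O ≤ Q := fun x hx => ⟨x, hx, 0, zero_mem O, by simp⟩
      exact ha.2 (hO.le_of_ge hQ hOQ ⟨0, zero_mem O, 1, one_mem O, by simp⟩)
    obtain ⟨s, hs, t, ht, hst⟩ := hQ
    have ht0 : t ≠ 0 := by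
      rintro rfl
      exact hO.prop (by simpa [hst] using hs)
    have : a = (1 + s) * t * t⁻¹ ^ 2 := by
      field_simp
      linear_combination hst
    rw [this] at ha
    exact ha.1 (mul_mem (mul_mem (add_mem (one_mem O) hs) ht) (hO₀ (hsq _)))
  refine ⟨O, hO₀, ⟨fun x hx hx' => ?_, fun x _ y _ => by simpa using htot (x - y)⟩, htot⟩
  by_contra hx0
  refine hO.prop ?_
  have : (-1 : E) = x * -x * x⁻¹ ^ 2 := by
    field_simp
  rw [this]
  exact mul_mem (mul_mem hx hx') (hO₀ (hsq _))

variable {K : Type*} [Field K] [LinearOrder K] [IsStrictOrderedRing K]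

/-- The elements `p * x ^ 2` of `K[X] / (f)` with `p ≥ 0` in `K`. -/
def nonnegMulSq (f : K[X]) : Submonoid (AdjoinRoot f) where
  carrier := {y | ∃ p x, 0 ≤ p ∧ y = AdjoinRoot.of f p * x ^ 2}
  mul_mem' := by
    rintro _ _ ⟨p, x, hp, rfl⟩ ⟨q, y, hq, rfl⟩
    exact ⟨p * q, x * y, mul_nonneg hp hq, by rw [map_mul]; ring⟩
  one_mem' := ⟨1, 1, zero_le_one, by simp⟩

theorem exists_nonneg_mk_eq {f : K[X]} (hf : f ≠ 0) {y : AdjoinRoot f}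
    (h : y ∈ (nonnegMulSq f).subsemiringClosure) :
    ∃ n : K[X], n.natDegree ≤ 2 * (f.natDegree - 1) ∧ (∀ c, 0 ≤ n.eval c) ∧
      AdjoinRoot.mk f n = y := by
  rw [Submonoid.subsemiringClosure_mem] at h
  induction h using AddSubmonoid.closure_induction with
  | mem y hy =>
    obtain ⟨p, x, hp, rfl⟩ := hy
    obtain ⟨g, rfl⟩ := AdjoinRoot.mk_surjective x
    have hg : (g % f).natDegree ≤ f.natDegree - 1 := by
      rcases eq_or_ne (g % f) 0 with h0 | h0
      · simp [h0]
      · have := natDegree_lt_natDegree h0 (degree_mod_lt g hf)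
        omega
    refine ⟨C p * (g % f) ^ 2, ?_, fun c => by simp; positivity, ?_⟩
    · exact (natDegree_C_mul_le _ _).trans (natDegree_pow_le_of_le 2 hg)
    · have : AdjoinRoot.mk f (g % f) = AdjoinRoot.mk f g := by
        rw [AdjoinRoot.mk_eq_mk]
        exact (EuclideanDomain.mod_eq_sub_mul_div g f).symm ▸ ⟨-(g / f), by ring⟩
      rw [map_mul, map_pow, this, AdjoinRoot.mk_C]
  | zero => exact ⟨0, by simp, by simp, by simp⟩
  | add y z _ _ hy hz =>
    obtain ⟨n, hn, hn0, rfl⟩ := hy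
    obtain ⟨m, hm, hm0, rfl⟩ := hz
    exact ⟨n + m, natDegree_add_le_of_degree_le hn hm,
      fun c => by simpa using add_nonneg (hn0 c) (hm0 c), map_add _ _ _⟩

theorem exists_isTotalCone_adjoinRoot {f : K[X]} (hf : Irreducible f)
    (h : -1 ∉ (nonnegMulSq f).subsemiringClosure) :
    ∃ O : Subsemiring (AdjoinRoot f), IsTotalCone O ∧ (∀ x, x ∈ O ∨ -x ∈ O) ∧
      ∀ c, 0 ≤ c → AdjoinRoot.of f c ∈ O := by
  have := Fact.mk hf
  have hmem : ∀ p x, 0 ≤ p → AdjoinRoot.of f p * x ^ 2 ∈ (nonnegMulSq f).subsemiringClosure :=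
    fun p x hp => (Submonoid.subsemiringClosure_mem _).2
      (AddSubmonoid.subset_closure ⟨p, x, hp, rfl⟩)
  obtain ⟨O, hO, hcone, htot⟩ := exists_isTotalCone_of_neg_one_notMem
    (fun x => by simpa using hmem 1 x zero_le_one) h
  exact ⟨O, hcone, htot, fun c hc => hO (by simpa using hmem c 1 hc)⟩

theorem exists_root_of_natDegree_le_one {f : K[X]} (hf : f.natDegree ≤ 1) {a b : K} (hab : a < b)
    (hneg : f.eval a * f.eval b < 0) : ∃ c, a < c ∧ c < b ∧ f.eval c = 0 := by
  obtain ⟨u, v, rfl⟩ := exists_eq_X_add_C_of_natDegree_le_one hf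
  simp only [eval_add, eval_mul, eval_C, eval_X] at hneg ⊢
  rcases eq_or_ne u 0 with rfl | hu
  · nlinarith [mul_self_nonneg v]
  have hfac : ∀ x, u * x + v = u * (x - -v / u) := fun x => by field_simp; ring
  refine ⟨-v / u, ?_, ?_, by field_simp; ring⟩ <;> by_contra! hc
  · refine hneg.not_ge ?_
    rw [hfac, hfac, mul_mul_mul_comm]
    exact mul_nonneg (mul_self_nonneg u) (mul_nonneg (by linarith) (by linarith))
  · refine hneg.not_ge ?_
    rw [hfac, hfac, mul_mul_mul_comm]
    exact mul_nonneg (mul_self_nonneg u) (mul_nonneg_of_nonpos_of_nonpos (by linarith)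
      (by linarith))

theorem polynomialIVT_of_maximal (hK : ∀ f : K[X], Irreducible f →
    ∀ O : Subsemiring (AdjoinRoot f), IsTotalCone O → (∀ x, x ∈ O ∨ -x ∈ O) →
      (∀ c, 0 ≤ c → AdjoinRoot.of f c ∈ O) → f.natDegree ≤ 1) : PolynomialIVT K := by
  intro f a b hab
  induction hd : f.natDegree using Nat.strong_induction_on generalizing f with
  | _ d ih =>
  intro hneg
  have hf0 : f ≠ 0 := by
    rintro rfl
    simp at hneg
  have hunit : ¬IsUnit f := fun h => by
    obtain ⟨r, -, rfl⟩ := Polynomial.isUnit_iff.1 h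
    simp only [eval_C] at hneg
    exact hneg.not_ge (mul_self_nonneg r)
  by_cases hf : Irreducible f
  · by_cases hT : -1 ∈ (nonnegMulSq f).subsemiringClosure
    · obtain ⟨n, hn, hn0, hmk⟩ := exists_nonneg_mk_eq hf0 hT
      obtain ⟨h, hh⟩ : f ∣ 1 + n := by
        rw [← AdjoinRoot.mk_eq_zero, map_add, hmk, map_one, add_neg_cancel]
      have heval : ∀ c, 0 < f.eval c * h.eval c := fun c => by
        rw [← eval_mul, ← hh, eval_add, eval_one]
        exact add_pos_of_pos_of_nonneg one_pos (hn0 c)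
      have hh0 : h ≠ 0 := by
        rintro rfl
        simpa using heval a
      have hdeg : f.natDegree + h.natDegree ≤ 2 * (f.natDegree - 1) := by
        rw [← natDegree_mul hf0 hh0, ← hh]
        exact natDegree_add_le_of_degree_le (by simp) hn
      have hpos := hf.natDegree_pos
      have hab' := mul_pos (heval a) (heval b)
      rw [mul_mul_mul_comm] at hab'
      obtain ⟨c, -, -, hc⟩ := ih h.natDegree (by omega) h rfl (neg_of_mul_pos_right hab' hneg.le)
      simpa [hc] using heval c
    · obtain ⟨O, hO, htot, hof⟩ := exists_isTotalCone_adjoinRoot hf hT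
      exact exists_root_of_natDegree_le_one (hK f hf O hO htot hof) hab hneg
  · obtain ⟨g, h, hg, hh, hgh⟩ : ∃ g h, ¬IsUnit g ∧ ¬IsUnit h ∧ f = g * h := by
      by_contra! H
      exact hf ⟨hunit, fun {g h} hgh => by
        by_contra! hc
        exact H g h hc.1 hc.2 hgh⟩
    subst hgh
    have hg0 := left_ne_zero_of_mul hf0
    have hh0 := right_ne_zero_of_mul hf0
    rw [natDegree_mul hg0 hh0] at hd
    have hgd := natDegree_pos_iff_degree_pos.2 (degree_pos_of_ne_zero_of_nonunit hg0 hg)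
    have hhd := natDegree_pos_iff_degree_pos.2 (degree_pos_of_ne_zero_of_nonunit hh0 hh)
    simp only [eval_mul] at hneg ⊢
    rw [mul_mul_mul_comm] at hneg
    rcases mul_neg_iff.1 hneg with ⟨-, h'⟩ | ⟨h', -⟩
    · obtain ⟨c, hac, hcb, hc⟩ := ih h.natDegree (by omega) h rfl h'
      exact ⟨c, hac, hcb, by simp [hc]⟩
    · obtain ⟨c, hac, hcb, hc⟩ := ih g.natDegree (by omega) g rfl h'
      exact ⟨c, hac, hcb, by simp [hc]⟩

theorem exists_polynomialIVT_of_isTotalCone {Ω : Type u} [Field Ω] [IsAlgClosed Ω] [Countable Ω]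
    {P : Subsemiring Ω} (hP : IsTotalCone P) :
    ∃ (K : Type u) (_ : Field K) (_ : LinearOrder K) (_ : IsStrictOrderedRing K)
      (_ : Countable K) (e : K →+* Ω), (∀ x ∈ P, ∃ y, 0 ≤ y ∧ e y = x) ∧ PolynomialIVT K := by
  obtain ⟨K, _, _, _, _, e, he, hK⟩ := exists_maximal_orderedField hP
  exact ⟨K, _, _, ‹_›, ‹_›, e, he, polynomialIVT_of_maximal hK⟩

end RealClosure

section Embedding

open Filter

theorem exists_strictMono_of_canonicallyOrderedAdd (S : Type u) [CommSemiring S] [LinearOrder S]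
    [IsStrictOrderedRing S] [CanonicallyOrderedAdd S] [Countable S] :
    ∃ (K : Type u) (_ : Field K) (_ : LinearOrder K) (_ : IsStrictOrderedRing K)
      (_ : Countable K) (e : S →+* K), StrictMono e ∧ PolynomialIVT K := by
  obtain ⟨Ω, _, _, _, i, hi⟩ := exists_isAlgClosed_of_noZeroDivisors S fun x y =>
    (le_total x y).elim (fun h => (exists_add_of_le h).imp fun _ h => .inl h.symm)
      fun h => (exists_add_of_le h).imp fun _ h => .inr h.symm
  have hcone : IsTotalCone i.rangeS := by
    constructor
    · rintro _ ⟨x, rfl⟩ ⟨y, hy⟩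
      have : x + y = 0 := hi (by rw [map_add, hy, map_zero, add_neg_cancel])
      rw [(add_eq_zero.1 this).1, map_zero]
    · rintro _ ⟨x, rfl⟩ _ ⟨y, rfl⟩
      rcases le_total x y with h | h <;> obtain ⟨z, rfl⟩ := exists_add_of_le h
      · exact .inr ⟨z, by simp⟩
      · exact .inl ⟨z, by simp⟩
  obtain ⟨K, _, _, _, _, j, hj, hK⟩ := exists_polynomialIVT_of_isTotalCone hcone
  choose e he0 hje using fun x => hj (i x) ⟨x, rfl⟩
  let E : S →+* K :=
    { toFun := e
      map_one' := j.injective (by simp [hje])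
      map_zero' := j.injective (by simp [hje])
      map_add' := fun x y => j.injective (by simp [hje])
      map_mul' := fun x y => j.injective (by simp [hje]) }
  have hE : Function.Injective E := fun x y h => hi (by rw [← hje, ← hje]; exact congrArg j h)
  have hmono : Monotone E := fun x y h => by
    obtain ⟨z, rfl⟩ := exists_add_of_le h
    rw [map_add]
    exact le_add_of_nonneg_right (he0 z)
  exact ⟨K, _, _, ‹_›, ‹_›, E, hmono.strictMono_of_injective hE, hK⟩

theorem exists_seq_eventually_of_eventually {ι α : Type*} [Countable ι] {l : Filter α} [l.NeBot]
    {p : ι → α → Prop} (h : ∀ i, ∀ᶠ a in l, p i a) :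
    ∃ σ : ℕ → α, ∀ i, ∀ᶠ n in atTop, p i (σ n) := by
  have hle : l ≤ ⨅ i, 𝓟 {a | p i a} := le_iInf fun i => le_principal_iff.2 (h i)
  have : (⨅ i, 𝓟 {a | p i a}).NeBot := neBot_of_le hle
  obtain ⟨σ, hσ⟩ := exists_seq_tendsto (⨅ i, 𝓟 {a | p i a})
  exact ⟨σ, fun i => hσ.eventually (mem_iInf_of_mem i (mem_principal_self _))⟩

theorem exists_eventually_of_strictMono_germ {S k : Type*} [CommSemiring S] [LinearOrder S]
    [IsStrictOrderedRing S] [CanonicallyOrderedAdd S] [Countable S] [Field k] [LinearOrder k]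
    [IsStrictOrderedRing k] {φ : Ultrafilter ℕ} (θ : S →+* (φ : Filter ℕ).Germ k)
    (hθ : StrictMono θ) :
    ∃ r : S → ℕ → k, (∀ x n, 0 ≤ r x n) ∧ ∀ x y, ∀ᶠ n in atTop, r 0 n = 0 ∧ r 1 n = 1 ∧
      r (x + y) n = r x n + r y n ∧ r (x * y) n = r x n * r y n ∧ (r x n ≤ r y n ↔ x ≤ y) := by
  have hrep : ∀ x, ∃ g : ℕ → k, (∀ n, 0 ≤ g n) ∧ (g : (φ : Filter ℕ).Germ k) = θ x := by
    intro x
    obtain ⟨g, hg⟩ := Quotient.exists_rep (θ x)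
    have hg' : (g : (φ : Filter ℕ).Germ k) = θ x := hg
    have h0 : (0 : (φ : Filter ℕ).Germ k) ≤ θ x := by simpa using hθ.monotone (zero_le (a := x))
    refine ⟨fun n => max (g n) 0, fun n => le_max_right _ _, ?_⟩
    rw [← hg'] at h0 ⊢
    refine Germ.coe_eq.2 ?_
    filter_upwards [Germ.coe_le.1 h0] with n hn
    exact max_eq_left hn
  choose g hg0 hg using hrep
  obtain ⟨σ, hσ⟩ := exists_seq_eventually_of_eventually (l := (φ : Filter ℕ))
    (p := fun (q : S × S) n => g 0 n = 0 ∧ g 1 n = 1 ∧ g (q.1 + q.2) n = g q.1 n + g q.2 n ∧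
      g (q.1 * q.2) n = g q.1 n * g q.2 n ∧ (g q.1 n ≤ g q.2 n ↔ q.1 ≤ q.2)) <| by
    rintro ⟨x, y⟩
    refine eventually_and.2 ⟨Germ.coe_eq.1 (by rw [hg, map_zero]; rfl), eventually_and.2
      ⟨Germ.coe_eq.1 (by rw [hg, map_one]; rfl), eventually_and.2
      ⟨Germ.coe_eq.1 ((hg _).trans (by rw [map_add, ← hg, ← hg]; rfl)), eventually_and.2
      ⟨Germ.coe_eq.1 ((hg _).trans (by rw [map_mul, ← hg, ← hg]; rfl)), ?_⟩⟩⟩⟩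
    rcases le_or_gt x y with h | h
    · have := hθ.monotone h
      rw [← hg, ← hg] at this
      filter_upwards [Germ.coe_le.1 this] with n hn
      exact iff_of_true hn h
    · have := hθ h
      rw [← hg, ← hg] at this
      filter_upwards [Germ.coe_lt.1 this] with n hn
      exact iff_of_false hn.not_ge h.not_ge
  exact ⟨fun x n => g x (σ n), fun x n => hg0 x _, fun x y => hσ (x, y)⟩

theorem exists_germ_cofinite (S : Type*) [CommSemiring S] [LinearOrder S] [IsStrictOrderedRing S]
    [CanonicallyOrderedAdd S] [Countable S] :
    ∃ h : S → (cofinite : Filter ℕ).Germ ℝ,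
      Function.Injective h ∧
      (∀ x y, h (x + y) = h x + h y) ∧
      (∀ x y, h (x * y) = h x * h y) ∧
      h 0 = 0 ∧ h 1 = 1 ∧
      (∀ x y, h x ≤ h y ↔ x ≤ y) ∧
      (∀ m, ∃ f : ℕ → ℝ, (↑f : (cofinite : Filter ℕ).Germ ℝ) = h m ∧
        ∀ n : ℕ, 0 ≤ f n ∧ IsAlgebraic ℚ (f n)) := by
  obtain ⟨K, _, _, _, _, e, he, hK⟩ := exists_strictMono_of_canonicallyOrderedAdd S
  obtain ⟨φ, hφ⟩ := exists_strictMono_ringHom hK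
    (polynomialIVT_algebraicClosure_rat.germ (hyperfilter ℕ)) countablySaturated_germ
  obtain ⟨r, hr0, hr⟩ := exists_eventually_of_strictMono_germ (φ.comp e) (hφ.comp he)
  simp only [← Nat.cofinite_eq_atTop] at hr
  let h : S → (cofinite : Filter ℕ).Germ ℝ := fun x => ((fun n => (r x n : ℝ) : ℕ → ℝ) :)
  have hle : ∀ x y, h x ≤ h y ↔ x ≤ y := fun x y => by
    constructor
    · intro hxy
      obtain ⟨n, hn, -, -, -, -, hn'⟩ := ((Germ.coe_le.1 hxy).and (hr x y)).exists
      exact hn'.1 hn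
    · intro hxy
      refine Germ.coe_le.2 ?_
      filter_upwards [hr x y] with n hn
      exact hn.2.2.2.2.2 hxy
  refine ⟨h, fun x y hxy => le_antisymm ((hle _ _).1 hxy.le) ((hle _ _).1 hxy.ge),
    fun x y => Germ.coe_eq.2 ?_, fun x y => Germ.coe_eq.2 ?_, Germ.coe_eq.2 ?_, Germ.coe_eq.2 ?_,
    hle, fun m => ⟨_, rfl, fun n => ⟨hr0 m n, mem_algebraicClosure_iff.1 (r m n).2⟩⟩⟩
  · filter_upwards [hr x y] with n hn
    simp [hn.2.2.1]
  · filter_upwards [hr x y] with n hn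
    simp [hn.2.2.2.1]
  · filter_upwards [hr 0 0] with n hn
    simp [hn.1]
  · filter_upwards [hr 0 0] with n hn
    simp [hn.2.1]

end Embedding

namespace PAMinus

/-- A model of `PA⁻` is a commutative semiring. -/
@[reducible]
def commSemiring (M : Type*) [PAMinus M] : CommSemiring M where
  add_assoc := add_assoc
  add_comm := add_comm
  zero_add x := (add_comm 0 x).trans (add_zero x)
  add_zero := add_zero
  nsmul := nsmulRec
  mul_assoc := mul_assoc
  mul_comm := mul_comm
  one_mul x := (mul_comm 1 x).trans (mul_one x)
  mul_one := mul_one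
  zero_mul x := (mul_comm 0 x).trans (mul_zero x)
  mul_zero := mul_zero
  left_distrib := mul_add
  right_distrib x y z := by rw [mul_comm, mul_add, mul_comm z x, mul_comm z y]

attribute [local instance] commSemiring

theorem isStrictOrderedRing (M : Type*) [PAMinus M] : IsStrictOrderedRing M where
  add_le_add_left x y h z := h.eq_or_lt.elim (fun h => h ▸ le_rfl)
    fun h => (add_lt_add_right x y z h).le
  le_of_add_le_add_left x y z h := not_lt.1 fun hlt => h.not_gt <| by
    rw [add_comm x, add_comm x]
    exact add_lt_add_right z y x hlt
  zero_le_one := zero_le 1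
  exists_pair_ne := ⟨0, 1, zero_lt_one.ne⟩
  mul_lt_mul_of_pos_left x hx y z h := by
    rw [mul_comm x, mul_comm x]
    exact mul_lt_mul_right y z x hx h
  mul_lt_mul_of_pos_right x hx y z h := mul_lt_mul_right y z x hx h

theorem canonicallyOrderedAdd (M : Type*) [PAMinus M] : CanonicallyOrderedAdd M := by
  have := isStrictOrderedRing M
  exact
    { exists_add_of_le := fun {x y} h => h.eq_or_lt.elim (fun h => ⟨0, by simp [h]⟩)
        fun h => (exists_add_of_lt x y h).imp fun _ h => h.symm
      le_add_self := fun x y => le_add_of_nonneg_left (zero_le y)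
      le_self_add := fun x y => le_add_of_nonneg_right (zero_le y) }

end PAMinus

/-- **Tennenbaum.** Every countable model of `PA⁻` embeds into `𝔸^ω/𝓕`, where `𝔸`
is the set of nonnegative real algebraic numbers and `𝓕` is the cofinite filter. -/
theorem countable_PAMinus_embeds_in_algebraic_reduced_power
    (M : Type*) [PAMinus M] [Countable M] :
    ∃ h : M → (Filter.cofinite : Filter ℕ).Germ ℝ,
      Function.Injective h ∧
      (∀ x y : M, h (x + y) = h x + h y) ∧
      (∀ x y : M, h (x * y) = h x * h y) ∧
      h 0 = 0 ∧ h 1 = 1 ∧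
      (∀ x y : M, h x ≤ h y ↔ x ≤ y) ∧
      (∀ m : M, ∃ f : ℕ → ℝ, (↑f : (Filter.cofinite : Filter ℕ).Germ ℝ) = h m ∧
        ∀ n : ℕ, 0 ≤ f n ∧ IsAlgebraic ℚ (f n)) := by
  let _ := PAMinus.commSemiring M
  have := PAMinus.isStrictOrderedRing M
  have := PAMinus.canonicallyOrderedAdd M
  exact exists_germ_cofinite M
end

section
/- Let A and B be two models of PA⁻ with A countable, and suppose that every finite system of polynomial equations with natural-number coefficients that has a solution in A also has a solution in B. Then A can be embedded into the reduced power B^ω/𝓕: there is an injective map h from A into the germs of functions ℕ → B at the cofinite filter preserving +, ·, 0, 1 and satisfying h(x) ≤ h(y) if and only if x ≤ y. -/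
namespace PAMinus

variable {M : Type*} [PAMinus M]

theorem lt_of_add_add_one_eq {x w y : M} (h : x + (w + 1) = y) : x < y := by
  have h1 : (0 : M) < w + 1 := by
    have h2 := PAMinus.add_lt_add_right (0 : M) 1 w PAMinus.zero_lt_one
    rw [PAMinus.add_comm 1 w] at h2
    exact lt_of_le_of_lt (PAMinus.zero_le _) h2
  have h3 := PAMinus.add_lt_add_right _ _ x h1
  rwa [PAMinus.add_comm 0 x, PAMinus.add_zero, PAMinus.add_comm _ x, h] at h3

theorem exists_add_add_one_eq {x y : M} (h : x < y) : ∃ w : M, x + (w + 1) = y := by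
  obtain ⟨z, rfl⟩ := PAMinus.exists_add_of_lt x y h
  have hz : 0 < z := by
    refine lt_of_le_of_ne (PAMinus.zero_le z) ?_
    rintro rfl
    rw [PAMinus.add_zero] at h
    exact lt_irrefl _ h
  rcases eq_or_lt_of_le (PAMinus.one_le_of_pos z hz) with rfl | h1
  · exact ⟨0, by rw [PAMinus.add_comm 0 1, PAMinus.add_zero]⟩
  · obtain ⟨w, rfl⟩ := PAMinus.exists_add_of_lt 1 z h1
    exact ⟨w, by rw [PAMinus.add_comm w 1]⟩

end PAMinus

/-- Solvability of finite systems transfers to maps that preserve the positive diagram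
of a finite subset. -/
theorem exists_map_preserving_diagram_on {A B : Type*} [Add A] [Mul A] [Zero A] [One A]
    [Add B] [Mul B] [Zero B] [One B]
    (hAB : ∀ (k : ℕ) (S : List (ArTerm k × ArTerm k)),
      (∃ a : Fin k → A, ∀ p ∈ S, p.1.eval a = p.2.eval a) →
      (∃ b : Fin k → B, ∀ p ∈ S, p.1.eval b = p.2.eval b)) (s : Finset A) :
    ∃ g : A → B,
      (∀ x ∈ s, ∀ y ∈ s, x + y ∈ s → g (x + y) = g x + g y) ∧
      (∀ x ∈ s, ∀ y ∈ s, x * y ∈ s → g (x * y) = g x * g y) ∧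
      ((0 : A) ∈ s → g 0 = 0) ∧ ((1 : A) ∈ s → g 1 = 1) := by
  classical
  let k := s.card
  let a : Fin k → A := fun i => (s.equivFin.symm i : A)
  let T : Set (ArTerm k × ArTerm k) :=
    Set.range (fun t : Fin k × Fin k × Fin k =>
        (ArTerm.var t.1, ArTerm.add (ArTerm.var t.2.1) (ArTerm.var t.2.2))) ∪
      Set.range (fun t : Fin k × Fin k × Fin k =>
        (ArTerm.var t.1, ArTerm.mul (ArTerm.var t.2.1) (ArTerm.var t.2.2))) ∪
      Set.range (fun i : Fin k => (ArTerm.var i, ArTerm.zero)) ∪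
      Set.range (fun i : Fin k => (ArTerm.var i, ArTerm.one))
  have hT : T.Finite :=
    (((Set.finite_range _).union (Set.finite_range _)).union (Set.finite_range _)).union
      (Set.finite_range _)
  have hS : {p ∈ T | p.1.eval a = p.2.eval a}.Finite := hT.sep _
  obtain ⟨b, hb⟩ := hAB k hS.toFinset.toList ⟨a, fun p hp => by
    rw [Finset.mem_toList, Set.Finite.mem_toFinset] at hp
    exact hp.2⟩
  have hb' : ∀ p ∈ T, p.1.eval a = p.2.eval a → p.1.eval b = p.2.eval b := fun p hp h =>
    hb p (by rw [Finset.mem_toList, Set.Finite.mem_toFinset]; exact ⟨hp, h⟩)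
  let g : A → B := fun x => if hx : x ∈ s then b (s.equivFin ⟨x, hx⟩) else 0
  have hg : ∀ x (hx : x ∈ s), g x = b (s.equivFin ⟨x, hx⟩) := fun x hx => dif_pos hx
  have ha : ∀ x (hx : x ∈ s), a (s.equivFin ⟨x, hx⟩) = x := fun x hx => by simp [a]
  refine ⟨g, fun x hx y hy hxy => ?_, fun x hx y hy hxy => ?_, fun h => ?_, fun h => ?_⟩
  · rw [hg _ hx, hg _ hy, hg _ hxy]
    simpa only [ArTerm.eval] using hb' _
      (.inl (.inl (.inl ⟨(s.equivFin ⟨_, hxy⟩, s.equivFin ⟨x, hx⟩,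
        s.equivFin ⟨y, hy⟩), rfl⟩)))
      (by simp only [ArTerm.eval, ha])
  · rw [hg _ hx, hg _ hy, hg _ hxy]
    simpa only [ArTerm.eval] using hb' _
      (.inl (.inl (.inr ⟨(s.equivFin ⟨_, hxy⟩, s.equivFin ⟨x, hx⟩,
        s.equivFin ⟨y, hy⟩), rfl⟩)))
      (by simp only [ArTerm.eval, ha])
  · rw [hg _ h]
    simpa only [ArTerm.eval] using hb' _ (.inl (.inr ⟨s.equivFin ⟨_, h⟩, rfl⟩)) (by simp only [ArTerm.eval, ha])
  · rw [hg _ h]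
    simpa only [ArTerm.eval] using hb' _ (.inr ⟨s.equivFin ⟨_, h⟩, rfl⟩) (by simp only [ArTerm.eval, ha])

/-- If `A` and `B` are models of `PA⁻`, `A` is countable, and every finite system
of polynomial equations with natural-number coefficients solvable in `A` is
solvable in `B`, then `A` embeds into the reduced power `B^ω/𝓕`. -/
theorem countable_embeds_in_reduced_power_of_dioph_transfer
    (A B : Type*) [PAMinus A] [PAMinus B] [Countable A]
    (hAB : ∀ (k : ℕ) (S : List (ArTerm k × ArTerm k)),
      (∃ a : Fin k → A, ∀ p ∈ S, p.1.eval a = p.2.eval a) →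
      (∃ b : Fin k → B, ∀ p ∈ S, p.1.eval b = p.2.eval b)) :
    ∃ h : A → (Filter.cofinite : Filter ℕ).Germ B,
      Function.Injective h ∧
      (∀ x y : A, h (x + y) = h x + h y) ∧
      (∀ x y : A, h (x * y) = h x * h y) ∧
      h 0 = 0 ∧ h 1 = 1 ∧
      (∀ x y : A, h x ≤ h y ↔ x ≤ y) := by
  classical
  have : Nonempty A := ⟨0⟩
  obtain ⟨e, he⟩ := exists_surjective_nat A
  let s : ℕ → Finset A := fun n => (Finset.range n).image e
  have hs : ∀ x, ∀ᶠ n in (Filter.cofinite : Filter ℕ), x ∈ s n := fun x => by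
    obtain ⟨i, rfl⟩ := he x
    rw [Nat.cofinite_eq_atTop]
    filter_upwards [Filter.eventually_gt_atTop i] with n hn
    exact Finset.mem_image_of_mem e (Finset.mem_range.2 hn)
  choose f hadd hmul hzero hone using fun n => exists_map_preserving_diagram_on hAB (s n)
  have add' : ∀ x y, ∀ᶠ n in (Filter.cofinite : Filter ℕ), f n (x + y) = f n x + f n y :=
    fun x y => by
      filter_upwards [hs x, hs y, hs (x + y)] with n h1 h2 h3 using hadd n x h1 y h2 h3
  have mul' : ∀ x y, ∀ᶠ n in (Filter.cofinite : Filter ℕ), f n (x * y) = f n x * f n y :=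
    fun x y => by
      filter_upwards [hs x, hs y, hs (x * y)] with n h1 h2 h3 using hmul n x h1 y h2 h3
  have zero' : ∀ᶠ n in (Filter.cofinite : Filter ℕ), f n 0 = 0 := by
    filter_upwards [hs 0] with n h using hzero n h
  have one' : ∀ᶠ n in (Filter.cofinite : Filter ℕ), f n 1 = 1 := by
    filter_upwards [hs 1] with n h using hone n h
  have lt' : ∀ x y, x < y → ∀ᶠ n in (Filter.cofinite : Filter ℕ), f n x < f n y := by
    intro x y hxy
    obtain ⟨w, rfl⟩ := PAMinus.exists_add_add_one_eq hxy
    filter_upwards [add' x (w + 1), add' w 1, one'] with n h1 h2 h3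
    refine PAMinus.lt_of_add_add_one_eq (w := f n w) ?_
    rw [h1, h2, h3]
  let h : A → (Filter.cofinite : Filter ℕ).Germ B := fun x => ((fun n => f n x : ℕ → B) : _)
  have hle : ∀ x y : A, h x ≤ h y ↔ x ≤ y := by
    refine fun x y => ⟨fun hxy => ?_, fun hxy => ?_⟩
    · by_contra hlt
      have hxy' : ∀ᶠ n in (Filter.cofinite : Filter ℕ), f n x ≤ f n y := hxy
      obtain ⟨n, h1, h2⟩ := (hxy'.and (lt' y x (not_le.1 hlt))).exists
      exact absurd h1 (not_le.2 h2)
    · rcases eq_or_lt_of_le hxy with rfl | hlt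
      · exact le_refl (h x)
      · exact (lt' x y hlt).mono fun n hn => hn.le
  refine ⟨h, fun x y hxy => ?_, fun x y => ?_, fun x y => ?_, ?_, ?_, hle⟩
  · exact le_antisymm ((hle x y).1 hxy.le) ((hle y x).1 hxy.ge)
  · exact Filter.Germ.coe_eq.2 (add' x y)
  · exact Filter.Germ.coe_eq.2 (mul' x y)
  · exact Filter.Germ.coe_eq.2 zero'
  · exact Filter.Germ.coe_eq.2 one'
end

section
/- Let M be a Diophantine correct model of PA⁻ of cardinality at most ℵ₁, and let D be a proper regular filter on ℕ, i.e. a filter D with ∅ ∉ D for which there exists a countable family A₀, A₁, A₂, … of members of D such that every natural number belongs to only finitely many of the Aₙ. Then M can be embedded into ℕ^ω/D: there is an injective map h from M into the germs of functions ℕ → ℕ at the filter D preserving +, ·, 0, 1 and satisfying h(x) ≤ h(y) if and only if x ≤ y. -/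
open Filter

section DiagramLift

variable {M : Type*} [Add M] [Mul M] [Zero M] [One M]

/-- `v` preserves `+`, `·`, `0`, `1` as far as these are visible inside the set `F`. -/
structure IsPartialHom {N : Type*} [Add N] [Mul N] [Zero N] [One N]
    (F : Set M) (v : M → N) : Prop where
  add : ∀ x ∈ F, ∀ y ∈ F, ∀ z ∈ F, x + y = z → v x + v y = v z
  mul : ∀ x ∈ F, ∀ y ∈ F, ∀ z ∈ F, x * y = z → v x * v y = v z
  zero : ∀ x ∈ F, x = 0 → v x = 0
  one : ∀ x ∈ F, x = 1 → v x = 1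

theorem IsPartialHom.mono {N : Type*} [Add N] [Mul N] [Zero N] [One N] {F G : Set M}
    {v : M → N} (hv : IsPartialHom G v) (h : F ⊆ G) : IsPartialHom F v where
  add x hx y hy z hz := hv.add x (h hx) y (h hy) z (h hz)
  mul x hx y hy z hz := hv.mul x (h hx) y (h hy) z (h hz)
  zero x hx := hv.zero x (h hx)
  one x hx := hv.one x (h hx)

theorem IsPartialHom.comp {N : Type*} [Add N] [Mul N] [Zero N] [One N] {F G : Set M}
    {v : M → N} {σ : M → M} (hv : IsPartialHom G v) (hσ : IsPartialHom F σ)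
    (h : Set.MapsTo σ F G) : IsPartialHom F (v ∘ σ) where
  add x hx y hy z hz e := hv.add _ (h hx) _ (h hy) _ (h hz) (hσ.add x hx y hy z hz e)
  mul x hx y hy z hz e := hv.mul _ (h hx) _ (h hy) _ (h hz) (hσ.mul x hx y hy z hz e)
  zero x hx e := hv.zero _ (h hx) (hσ.zero x hx e)
  one x hx e := hv.one _ (h hx) (hσ.one x hx e)

/-- The values `g x`, for `x ∈ X`, satisfy modulo `D` every positive primitive formula
that the elements `x ∈ X` satisfy in `M`. -/
def IsDiagramLift (D : Filter ℕ) (X : Set M) (g : M → ℕ → ℕ) : Prop :=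
  ∀ F : Finset M, ∀ᶠ m in D, ∃ v : M → ℕ,
    IsPartialHom (F : Set M) v ∧ ∀ x ∈ F, x ∈ X → v x = g x m

theorem IsDiagramLift.congr {D : Filter ℕ} {X : Set M} {g g' : M → ℕ → ℕ}
    (hg : IsDiagramLift D X g) (h : ∀ x ∈ X, g x = g' x) : IsDiagramLift D X g' := by
  intro F
  filter_upwards [hg F] with m ⟨v, hv, hvg⟩
  exact ⟨v, hv, fun x hx hX => by rw [hvg x hx hX, h x hX]⟩

/-- Every finite piece of a Diophantine correct structure maps to `ℕ`. -/
theorem DiophCorrect.exists_isPartialHom (hM : DiophCorrect M) (F : Finset M) :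
    ∃ v : M → ℕ, IsPartialHom (F : Set M) v := by
  classical
  let e := F.equivFin
  let a : Fin F.card → M := fun i => e.symm i
  let T : Set (ArTerm F.card × ArTerm F.card) :=
    {p | p.1.eval a = p.2.eval a} ∩
      (Set.range (fun t : Fin F.card × Fin F.card × Fin F.card =>
          (ArTerm.add (.var t.1) (.var t.2.1), ArTerm.var t.2.2)) ∪
        Set.range (fun t : Fin F.card × Fin F.card × Fin F.card =>
          (ArTerm.mul (.var t.1) (.var t.2.1), ArTerm.var t.2.2)) ∪
        Set.range (fun i : Fin F.card => (ArTerm.var i, ArTerm.zero)) ∪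
        Set.range (fun i : Fin F.card => (ArTerm.var i, ArTerm.one)))
  have hT : T.Finite := by
    refine Set.Finite.inter_of_right ?_ _
    exact (((Set.finite_range _).union (Set.finite_range _)).union
      (Set.finite_range _)).union (Set.finite_range _)
  obtain ⟨w, hw⟩ := hM F.card hT.toFinset.toList ⟨a, fun p hp => by
    rw [Finset.mem_toList, Set.Finite.mem_toFinset] at hp
    exact hp.1⟩
  replace hw : ∀ p ∈ T, p.1.eval w = p.2.eval w := fun p hp =>
    hw p (by rwa [Finset.mem_toList, Set.Finite.mem_toFinset])
  have ha : ∀ x (hx : x ∈ F), a (e ⟨x, hx⟩) = x := fun x hx => by simp [a]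
  refine ⟨fun x => if hx : x ∈ F then w (e ⟨x, hx⟩) else 0, ?_, ?_, ?_, ?_⟩
  · intro x hx y hy z hz h
    rw [Finset.mem_coe] at hx hy hz
    simp only [dif_pos hx, dif_pos hy, dif_pos hz]
    simpa only [ArTerm.eval] using hw (.add (.var (e ⟨x, hx⟩)) (.var (e ⟨y, hy⟩)), .var (e ⟨z, hz⟩))
      ⟨by simpa [ArTerm.eval, ha] using h, .inl (.inl (.inl ⟨(_, _, _), rfl⟩))⟩
  · intro x hx y hy z hz h
    rw [Finset.mem_coe] at hx hy hz
    simp only [dif_pos hx, dif_pos hy, dif_pos hz]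
    simpa only [ArTerm.eval] using hw (.mul (.var (e ⟨x, hx⟩)) (.var (e ⟨y, hy⟩)), .var (e ⟨z, hz⟩))
      ⟨by simpa [ArTerm.eval, ha] using h, .inl (.inl (.inr ⟨(_, _, _), rfl⟩))⟩
  · intro x hx h
    rw [Finset.mem_coe] at hx
    simp only [dif_pos hx]
    simpa only [ArTerm.eval] using hw (.var (e ⟨x, hx⟩), .zero)
      ⟨by simpa [ArTerm.eval, ha] using h, .inl (.inr ⟨_, rfl⟩)⟩
  · intro x hx h
    rw [Finset.mem_coe] at hx
    simp only [dif_pos hx]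
    simpa only [ArTerm.eval] using hw (.var (e ⟨x, hx⟩), .one)
      ⟨by simpa [ArTerm.eval, ha] using h, .inr ⟨_, rfl⟩⟩

theorem DiophCorrect.isDiagramLift_empty (hM : DiophCorrect M) (D : Filter ℕ)
    (g : M → ℕ → ℕ) : IsDiagramLift D ∅ g := fun F =>
  let ⟨v, hv⟩ := hM.exists_isPartialHom F
  .of_forall fun _ => ⟨v, hv, fun _ _ h => h.elim⟩

/-- The isomorphism type of a finite tuple `a`, coloured by `e`. -/
def diagramCode (e : M → ℕ) (a : Σ k : ℕ, Fin k → M) :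
    Σ k : ℕ, (Fin k → ℕ) × Set (Fin k × Fin k × Fin k) × Set (Fin k × Fin k × Fin k) ×
      Set (Fin k) × Set (Fin k) :=
  ⟨a.1, fun i => e (a.2 i), {t | a.2 t.1 + a.2 t.2.1 = a.2 t.2.2},
    {t | a.2 t.1 * a.2 t.2.1 = a.2 t.2.2}, {i | a.2 i = 0}, {i | a.2 i = 1}⟩

/-- Over a countable set `X` there are only countably many isomorphism types of finite
pieces of `M`. -/
theorem exists_countable_cofinal_finsets {X : Set M} (hX : X.Countable) :
    ∃ F : ℕ → Finset M, ∀ G : Finset M, ∃ n, ∃ σ : M → M,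
      IsPartialHom (G : Set M) σ ∧ Set.MapsTo σ G (F n) ∧ ∀ x ∈ G, x ∈ X → σ x = x := by
  classical
  obtain ⟨e, he⟩ : ∃ e : M → ℕ, ∀ x ∈ X, ∀ y, e y = e x → y = x := by
    obtain ⟨f, hf⟩ := Set.countable_iff_exists_injOn.1 hX
    refine ⟨fun x => if x ∈ X then f x + 1 else 0, fun x hx y h => ?_⟩
    by_cases hy : y ∈ X
    · simp only [if_pos hx, if_pos hy, Nat.add_right_cancel_iff] at h
      exact hf hy hx h
    · simp [hx, hy] at h
  let R := Set.range (diagramCode e)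
  have : Nonempty R := ⟨⟨_, ⟨⟨0, Fin.elim0⟩, rfl⟩⟩⟩
  obtain ⟨s, hs⟩ := exists_surjective_nat R
  choose b hb using fun n => (s n).2
  refine ⟨fun n => Finset.univ.image (b n).2, fun G => ?_⟩
  let a : Fin G.card → M := fun i => G.equivFin.symm i
  obtain ⟨n, hn⟩ := hs ⟨diagramCode e ⟨G.card, a⟩, ⟨_, rfl⟩⟩
  have hc : diagramCode e (b n) = diagramCode e ⟨G.card, a⟩ := by rw [hb n, hn]
  refine ⟨n, ?_⟩
  dsimp only
  generalize b n = c at hc ⊢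
  obtain ⟨k, c⟩ := c
  obtain rfl : k = G.card := congrArg Sigma.fst hc
  simp only [diagramCode, Sigma.mk.injEq, heq_eq_eq, true_and, Prod.mk.injEq,
    Set.ext_iff, Set.mem_ofPred_eq, Prod.forall] at hc
  obtain ⟨h1, h2, h3, h4, h5⟩ := hc
  have ha : ∀ x (hx : x ∈ G), a (G.equivFin ⟨x, hx⟩) = x := fun x hx => by simp [a]
  refine ⟨fun x => if hx : x ∈ G then c (G.equivFin ⟨x, hx⟩) else x,
    ⟨?_, ?_, ?_, ?_⟩, ?_, ?_⟩
  · intro x hx y hy z hz h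
    rw [Finset.mem_coe] at hx hy hz
    simp only [dif_pos hx, dif_pos hy, dif_pos hz]
    rwa [h2, ha, ha, ha]
  · intro x hx y hy z hz h
    rw [Finset.mem_coe] at hx hy hz
    simp only [dif_pos hx, dif_pos hy, dif_pos hz]
    rwa [h3, ha, ha, ha]
  · intro x hx h
    rw [Finset.mem_coe] at hx
    simp only [dif_pos hx]
    rwa [h4, ha]
  · intro x hx h
    rw [Finset.mem_coe] at hx
    simp only [dif_pos hx]
    rwa [h5, ha]
  · intro x hx
    rw [Finset.mem_coe] at hx
    simp [dif_pos hx]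
  · intro x hx hxX
    simp only [dif_pos hx]
    refine he x hxX _ ?_
    rw [congrFun h1, ha]

/-- A diagram lift on a countable set extends to one more element. -/
theorem IsDiagramLift.exists_extend {D : Filter ℕ} {A : ℕ → Set ℕ} (hA : ∀ n, A n ∈ D)
    (hfin : ∀ m : ℕ, {n : ℕ | m ∈ A n}.Finite) {X : Set M} (hX : X.Countable)
    {g : M → ℕ → ℕ} (hg : IsDiagramLift D X g) {b : M} (hb : b ∉ X) :
    ∃ c : ℕ → ℕ, ∀ g' : M → ℕ → ℕ, (∀ x ∈ X, g' x = g x) → g' b = c →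
      IsDiagramLift D (insert b X) g' := by
  classical
  obtain ⟨F, hF⟩ := exists_countable_cofinal_finsets (hX.insert b)
  let H : ℕ → Finset M := fun n => insert b ((Finset.range (n + 1)).biUnion F)
  let P : ℕ → ℕ → (M → ℕ) → Prop := fun n m v =>
    IsPartialHom (H n : Set M) v ∧ ∀ x ∈ H n, x ∈ X → v x = g x m
  have key : ∀ m, ∃ w : M → ℕ, ∀ n, m ∈ A n → (∃ v, P n m v) → ∃ N ≥ n, P N m w := by
    intro m
    have hf : {n | m ∈ A n ∧ ∃ v, P n m v}.Finite := (hfin m).subset fun n hn => hn.1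
    rcases Set.eq_empty_or_nonempty {n | m ∈ A n ∧ ∃ v, P n m v} with h | h
    · exact ⟨0, fun n h1 h2 => (Set.eq_empty_iff_forall_notMem.1 h n ⟨h1, h2⟩).elim⟩
    · obtain ⟨N, ⟨-, w, hw⟩, hmax⟩ := Set.exists_max_image _ id hf h
      exact ⟨w, fun n h1 h2 => ⟨N, hmax n ⟨h1, h2⟩, hw⟩⟩
  choose w hw using key
  refine ⟨fun m => w m b, fun g' hg' hg'b G => ?_⟩
  obtain ⟨n, σ, hσ, hmaps, hfix⟩ := hF G
  filter_upwards [hA n, hg (H n)] with m hmA hmv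
  obtain ⟨N, hN, hom, hval⟩ := hw m n hmA hmv
  have hsub : F n ⊆ H N := fun x hx => Finset.mem_insert_of_mem
    (Finset.mem_biUnion.2 ⟨n, Finset.mem_range.2 (by omega), hx⟩)
  refine ⟨w m ∘ σ, hom.comp hσ fun x hx => hsub (hmaps hx), fun x hx hxX => ?_⟩
  have hxσ := hfix x hx hxX
  have hxH : x ∈ H N := by
    have := hsub (hmaps hx)
    rwa [hxσ] at this
  rw [Function.comp_apply, hxσ]
  rcases hxX with rfl | hxX
  · rw [hg'b]
  · rw [hg' x hxX, hval x hxH hxX]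

/-- Diagram lifts are glued along the initial segments of a ranking. -/
theorem isDiagramLift_of_initial_segments {D : Filter ℕ} {f : M → Ordinal} {X : Set M}
    {g : M → ℕ → ℕ} (h0 : IsDiagramLift D ∅ g)
    (h : ∀ y ∈ X, IsDiagramLift D {x | f x ≤ f y} g) : IsDiagramLift D X g := by
  classical
  intro F
  rcases (F.filter (· ∈ X)).eq_empty_or_nonempty with he | hne
  · filter_upwards [h0 F] with m ⟨v, hv, _⟩
    exact ⟨v, hv, fun x hx hX => (Finset.filter_eq_empty_iff.1 he hx hX).elim⟩
  · obtain ⟨y, hy, hmax⟩ := Finset.exists_max_image _ f hne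
    filter_upwards [h y (Finset.mem_filter.1 hy).2 F] with m ⟨v, hv, hvg⟩
    exact ⟨v, hv, fun x hx hX => hvg x hx (hmax x (Finset.mem_filter.2 ⟨hx, hX⟩))⟩

theorem exists_injective_ordinal_countable_initial_segments.{u} {α : Type u}
    (h : Cardinal.mk α ≤ Cardinal.aleph 1) :
    ∃ f : α → Ordinal.{u}, Function.Injective f ∧ ∀ x, {y | f y < f x}.Countable := by
  obtain ⟨r, hr, hord⟩ := Cardinal.exists_ord_eq α
  refine ⟨fun x => Ordinal.typein r x, Ordinal.typein_injective r, fun x => ?_⟩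
  have h1 : Ordinal.typein r x < (Cardinal.aleph 1).ord :=
    ((Ordinal.typein_lt_type r x).trans_eq hord.symm).trans_le (Cardinal.ord_le_ord.2 h)
  have h2 := Cardinal.lt_ord.1 h1
  rw [← Cardinal.succ_aleph0, Order.lt_succ_iff] at h2
  rw [← Cardinal.le_aleph0_iff_set_countable]
  simpa using h2

theorem DiophCorrect.exists_isDiagramLift_univ (hM : DiophCorrect M)
    (hcard : Cardinal.mk M ≤ Cardinal.aleph 1) {D : Filter ℕ} {A : ℕ → Set ℕ}
    (hA : ∀ n, A n ∈ D) (hfin : ∀ m : ℕ, {n : ℕ | m ∈ A n}.Finite) :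
    ∃ g : M → ℕ → ℕ, IsDiagramLift D Set.univ g := by
  classical
  obtain ⟨f, hf, hcount⟩ := exists_injective_ordinal_countable_initial_segments hcard
  have wf : WellFounded (fun x y : M => f x < f y) := InvImage.wf f wellFounded_lt
  let extend (b : M) (g : M → ℕ → ℕ) (c : ℕ → ℕ) : Prop :=
    ∀ g' : M → ℕ → ℕ, (∀ x, f x < f b → g' x = g x) → g' b = c →
      IsDiagramLift D (insert b {x | f x < f b}) g'
  let step (b : M) (p : ∀ y, f y < f b → ℕ → ℕ) : ℕ → ℕ :=
    Classical.epsilon (extend b fun x => if hx : f x < f b then p x hx else 0)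
  let g : M → ℕ → ℕ := wf.fix step
  have hstep : ∀ b, g b =
      Classical.epsilon (extend b fun x => if f x < f b then g x else 0) := by
    intro b
    change wf.fix step b = _
    rw [wf.fix_eq]
    simp only [step, g, dite_eq_ite]
  have h0 := hM.isDiagramLift_empty D g
  have main : ∀ b, IsDiagramLift D {x | f x ≤ f b} g := by
    intro b
    induction b using wf.induction with
    | _ b ih =>
    have hlt : IsDiagramLift D {x | f x < f b} g :=
      isDiagramLift_of_initial_segments h0 ih
    have hext : ∃ c, extend b (fun x => if f x < f b then g x else 0) c :=
      (hlt.congr fun x (hx : f x < f b) => by simp [hx]).exists_extend hA hfin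
        (hcount b) (by simp)
    have := Classical.epsilon_spec hext g (fun x hx => by simp [hx]) (hstep b)
    convert this using 1
    ext x
    simp [le_iff_lt_or_eq, hf.eq_iff, or_comm]
  exact ⟨g, isDiagramLift_of_initial_segments h0 fun y _ => main y⟩

end DiagramLift

/-- Every Diophantine correct model of `PA⁻` of cardinality at most `ℵ₁` embeds
into the reduced power `ℕ^ω/D`, for any proper regular filter `D` on `ℕ`. -/
theorem dioph_correct_aleph_one_embeds_in_regular_reduced_power
    (M : Type*) [PAMinus M] (hcard : Cardinal.mk M ≤ Cardinal.aleph 1)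
    (hM : DiophCorrect M) (D : Filter ℕ) (hproper : (∅ : Set ℕ) ∉ D)
    (hreg : ∃ A : ℕ → Set ℕ, (∀ n : ℕ, A n ∈ D) ∧
      ∀ m : ℕ, {n : ℕ | m ∈ A n}.Finite) :
    ∃ h : M → D.Germ ℕ,
      Function.Injective h ∧
      (∀ x y : M, h (x + y) = h x + h y) ∧
      (∀ x y : M, h (x * y) = h x * h y) ∧
      h 0 = 0 ∧ h 1 = 1 ∧
      (∀ x y : M, h x ≤ h y ↔ x ≤ y) := by
  classical
  obtain ⟨A, hA, hfin⟩ := hreg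
  obtain ⟨g, hg⟩ := hM.exists_isDiagramLift_univ hcard hA hfin
  have hadd : ∀ x y : M, ∀ᶠ m in D, g (x + y) m = g x m + g y m := by
    intro x y
    filter_upwards [hg {x, y, x + y}] with m ⟨v, hv, hvg⟩
    rw [← hvg x (by simp) trivial, ← hvg y (by simp) trivial,
      ← hvg (x + y) (by simp) trivial]
    exact (hv.add x (by simp) y (by simp) _ (by simp) rfl).symm
  have hmul : ∀ x y : M, ∀ᶠ m in D, g (x * y) m = g x m * g y m := by
    intro x y
    filter_upwards [hg {x, y, x * y}] with m ⟨v, hv, hvg⟩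
    rw [← hvg x (by simp) trivial, ← hvg y (by simp) trivial,
      ← hvg (x * y) (by simp) trivial]
    exact (hv.mul x (by simp) y (by simp) _ (by simp) rfl).symm
  have hzero : ∀ᶠ m in D, g 0 m = 0 := by
    filter_upwards [hg {0}] with m ⟨v, hv, hvg⟩
    rw [← hvg 0 (by simp) trivial]
    exact hv.zero 0 (by simp) rfl
  have hone : ∀ᶠ m in D, g 1 m = 1 := by
    filter_upwards [hg {1}] with m ⟨v, hv, hvg⟩
    rw [← hvg 1 (by simp) trivial]
    exact hv.one 1 (by simp) rfl
  have hle : ∀ x y : M, x ≤ y → ∀ᶠ m in D, g x m ≤ g y m := by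
    intro x y hxy
    rcases hxy.eq_or_lt with rfl | hxy
    · exact .of_forall fun _ => le_rfl
    · obtain ⟨z, rfl⟩ := PAMinus.exists_add_of_lt x y hxy
      filter_upwards [hadd x z] with m hm
      omega
  have hlt : ∀ x y : M, x < y → ∀ᶠ m in D, g x m < g y m := by
    intro x y hxy
    obtain ⟨z, rfl⟩ := PAMinus.exists_add_of_lt x y hxy
    have hz : z ≠ 0 := by
      rintro rfl
      exact hxy.ne (PAMinus.add_zero x).symm
    have hz1 := PAMinus.one_le_of_pos z (lt_of_le_of_ne (PAMinus.zero_le z) hz.symm)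
    filter_upwards [hadd x z, hle 1 z hz1, hone] with m h1 h2 h3
    omega
  have hord : ∀ x y : M, (∀ᶠ m in D, g x m ≤ g y m) → x ≤ y := by
    intro x y h
    by_contra! hyx
    have hfalse : ∀ᶠ _ in D, False := by
      filter_upwards [h, hlt y x hyx] with m h1 h2
      omega
    exact hproper hfalse
  refine ⟨fun x => (g x : D.Germ ℕ), fun x y hxy => ?_, fun x y => ?_, fun x y => ?_,
    ?_, ?_, fun x y => ⟨fun h => hord x y (Germ.coe_le.1 h), fun h => Germ.coe_le.2 (hle x y h)⟩⟩
  · have h : g x =ᶠ[D] g y := Germ.coe_eq.1 hxy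
    exact le_antisymm (hord x y h.le) (hord y x h.symm.le)
  · exact Germ.coe_eq.2 (hadd x y)
  · exact Germ.coe_eq.2 (hmul x y)
  · exact Germ.coe_eq.2 hzero
  · exact Germ.coe_eq.2 hone
end
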